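/- For every z in the upper half-plane ℍ, Φ₁₈(x(z)) = Δ(z)·E₆(z), where x(z) = (x₁(z),...,x₆(z)) is the vector of eta-multiplied theta constants of order 13, Δ(z) = η(z)²⁴ is the modular discriminant and E₆ is the normalized Eisenstein series of weight 6. -/

import Mathlib

noncomputable section

open Complex

def ζ : ℂ := Complex.exp (2 * Real.pi * Complex.I / 13)

def AA0 (v : Fin 6 → ℂ) : ℂ := v 0 * v 3 + v 1 * v 4 + v 2 * v 5
def AA1 (v : Fin 6 → ℂ) : ℂ := (v 0) ^ 2 - 2 * v 2 * v 3
def AA2 (v : Fin 6 → ℂ) : ℂ := -(v 4) ^ 2 - 2 * v 1 * v 3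
def AA3 (v : Fin 6 → ℂ) : ℂ := (v 1) ^ 2 - 2 * v 0 * v 4
def AA4 (v : Fin 6 → ℂ) : ℂ := (v 2) ^ 2 - 2 * v 1 * v 5
def AA5 (v : Fin 6 → ℂ) : ℂ := -(v 3) ^ 2 - 2 * v 0 * v 5
def AA6 (v : Fin 6 → ℂ) : ℂ := -(v 5) ^ 2 - 2 * v 2 * v 4

def DD0 (v : Fin 6 → ℂ) : ℂ := v 0 * v 1 * v 2
def DD1 (v : Fin 6 → ℂ) : ℂ := 2 * v 1 * (v 2) ^ 2 + (v 1) ^ 2 * v 5 - (v 3) ^ 2 * v 4 + v 0 * v 4 * v 5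
def DD2 (v : Fin 6 → ℂ) : ℂ := -(v 5) ^ 3 + (v 1) ^ 2 * v 3 - 2 * v 1 * (v 4) ^ 2 + v 0 * v 3 * v 4 + 3 * v 2 * v 4 * v 5
def DD3 (v : Fin 6 → ℂ) : ℂ := 2 * v 0 * (v 1) ^ 2 + (v 0) ^ 2 * v 4 - v 3 * (v 5) ^ 2 + v 2 * v 3 * v 4
def DD4 (v : Fin 6 → ℂ) : ℂ := -(v 1) ^ 2 * v 2 + v 0 * (v 5) ^ 2 - 2 * (v 3) ^ 2 * v 5 - v 0 * v 2 * v 4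
def DD5 (v : Fin 6 → ℂ) : ℂ := -(v 3) ^ 3 + (v 2) ^ 2 * v 4 - 2 * v 2 * (v 5) ^ 2 + v 1 * v 4 * v 5 + 3 * v 0 * v 3 * v 5
def DD6 (v : Fin 6 → ℂ) : ℂ := -(v 4) ^ 3 + (v 0) ^ 2 * v 5 - 2 * v 0 * (v 3) ^ 2 + v 2 * v 3 * v 5 + 3 * v 1 * v 3 * v 4
def DD7 (v : Fin 6 → ℂ) : ℂ := -(v 1) ^ 3 + v 2 * (v 3) ^ 2 - v 0 * v 2 * v 5 - 3 * v 0 * v 1 * v 4 + 2 * (v 0) ^ 2 * v 3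
def DD8 (v : Fin 6 → ℂ) : ℂ := -(v 0) ^ 3 + v 1 * (v 5) ^ 2 - v 1 * v 2 * v 4 - 3 * v 0 * v 2 * v 3 + 2 * (v 2) ^ 2 * v 5
def DD9 (v : Fin 6 → ℂ) : ℂ := 2 * (v 0) ^ 2 * v 2 + (v 2) ^ 2 * v 3 - (v 4) ^ 2 * v 5 + v 1 * v 3 * v 5
def DD10 (v : Fin 6 → ℂ) : ℂ := -(v 0) * (v 2) ^ 2 + v 1 * (v 3) ^ 2 - 2 * v 3 * (v 4) ^ 2 - v 0 * v 1 * v 5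
def DD11 (v : Fin 6 → ℂ) : ℂ := -(v 2) ^ 3 + v 0 * (v 4) ^ 2 - v 0 * v 1 * v 3 - 3 * v 1 * v 2 * v 5 + 2 * (v 1) ^ 2 * v 4
def DD12 (v : Fin 6 → ℂ) : ℂ := -(v 0) ^ 2 * v 1 + v 2 * (v 4) ^ 2 - 2 * v 4 * (v 5) ^ 2 - v 1 * v 2 * v 3
def DDinf (v : Fin 6 → ℂ) : ℂ := v 3 * v 4 * v 5

def GG0 (v : Fin 6 → ℂ) : ℂ := (DD0 v) ^ 2 + (DDinf v) ^ 2
def GG1 (v : Fin 6 → ℂ) : ℂ := -(DD7 v) ^ 2 + 2 * DD0 v * DD1 v + 10 * DDinf v * DD1 v + 2 * DD2 v * DD12 v - 2 * DD3 v * DD11 v - 4 * DD4 v * DD10 v - 2 * DD9 v * DD5 v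
def GG2 (v : Fin 6 → ℂ) : ℂ := -2 * (DD1 v) ^ 2 - 4 * DD0 v * DD2 v + 6 * DDinf v * DD2 v - 2 * DD4 v * DD11 v + 2 * DD5 v * DD10 v - 2 * DD6 v * DD9 v - 2 * DD7 v * DD8 v
def GG3 (v : Fin 6 → ℂ) : ℂ := -(DD8 v) ^ 2 + 2 * DD0 v * DD3 v + 10 * DDinf v * DD3 v + 2 * DD6 v * DD10 v - 2 * DD9 v * DD7 v - 4 * DD12 v * DD4 v - 2 * DD1 v * DD2 v
def GG4 (v : Fin 6 → ℂ) : ℂ := -(DD2 v) ^ 2 + 10 * DD0 v * DD4 v - 2 * DDinf v * DD4 v + 2 * DD5 v * DD12 v - 2 * DD9 v * DD8 v - 4 * DD1 v * DD3 v - 2 * DD10 v * DD7 v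
def GG5 (v : Fin 6 → ℂ) : ℂ := -2 * (DD9 v) ^ 2 - 4 * DD0 v * DD5 v + 6 * DDinf v * DD5 v - 2 * DD10 v * DD8 v + 2 * DD6 v * DD12 v - 2 * DD2 v * DD3 v - 2 * DD11 v * DD7 v
def GG6 (v : Fin 6 → ℂ) : ℂ := -2 * (DD3 v) ^ 2 - 4 * DD0 v * DD6 v + 6 * DDinf v * DD6 v - 2 * DD12 v * DD7 v + 2 * DD2 v * DD4 v - 2 * DD5 v * DD1 v - 2 * DD8 v * DD11 v
def GG7 (v : Fin 6 → ℂ) : ℂ := -2 * (DD10 v) ^ 2 + 6 * DD0 v * DD7 v + 4 * DDinf v * DD7 v - 2 * DD1 v * DD6 v - 2 * DD2 v * DD5 v - 2 * DD8 v * DD12 v - 2 * DD9 v * DD11 v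
def GG8 (v : Fin 6 → ℂ) : ℂ := -2 * (DD4 v) ^ 2 + 6 * DD0 v * DD8 v + 4 * DDinf v * DD8 v - 2 * DD3 v * DD5 v - 2 * DD6 v * DD2 v - 2 * DD11 v * DD10 v - 2 * DD1 v * DD7 v
def GG9 (v : Fin 6 → ℂ) : ℂ := -(DD11 v) ^ 2 + 2 * DD0 v * DD9 v + 10 * DDinf v * DD9 v + 2 * DD5 v * DD4 v - 2 * DD1 v * DD8 v - 4 * DD10 v * DD12 v - 2 * DD3 v * DD6 v
def GG10 (v : Fin 6 → ℂ) : ℂ := -(DD5 v) ^ 2 + 10 * DD0 v * DD10 v - 2 * DDinf v * DD10 v + 2 * DD6 v * DD4 v - 2 * DD3 v * DD7 v - 4 * DD9 v * DD1 v - 2 * DD12 v * DD11 v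
def GG11 (v : Fin 6 → ℂ) : ℂ := -2 * (DD12 v) ^ 2 + 6 * DD0 v * DD11 v + 4 * DDinf v * DD11 v - 2 * DD9 v * DD2 v - 2 * DD5 v * DD6 v - 2 * DD7 v * DD4 v - 2 * DD3 v * DD8 v
def GG12 (v : Fin 6 → ℂ) : ℂ := -(DD6 v) ^ 2 + 10 * DD0 v * DD12 v - 2 * DDinf v * DD12 v + 2 * DD2 v * DD10 v - 2 * DD1 v * DD11 v - 4 * DD3 v * DD9 v - 2 * DD4 v * DD8 v

def wInf (v : Fin 6 → ℂ) : ℂ := 13 * (AA0 v) ^ 2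
def wF (ν : ℕ) (v : Fin 6 → ℂ) : ℂ :=
  (AA0 v + ζ ^ ν * AA1 v + ζ ^ (4 * ν) * AA2 v + ζ ^ (9 * ν) * AA3 v + ζ ^ (3 * ν) * AA4 v
    + ζ ^ (12 * ν) * AA5 v + ζ ^ (10 * ν) * AA6 v) ^ 2
def dInf (v : Fin 6 → ℂ) : ℂ := 13 ^ 2 * GG0 v
def dF (ν : ℕ) (v : Fin 6 → ℂ) : ℂ :=
  -13 * GG0 v + ζ ^ ν * GG1 v + ζ ^ (2 * ν) * GG2 v + ζ ^ (3 * ν) * GG3 v + ζ ^ (4 * ν) * GG4 v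
    + ζ ^ (5 * ν) * GG5 v + ζ ^ (6 * ν) * GG6 v + ζ ^ (7 * ν) * GG7 v + ζ ^ (8 * ν) * GG8 v
    + ζ ^ (9 * ν) * GG9 v + ζ ^ (10 * ν) * GG10 v + ζ ^ (11 * ν) * GG11 v + ζ ^ (12 * ν) * GG12 v

def Phi12 (v : Fin 6 → ℂ) : ℂ :=
  -(1 / (13 * 52) : ℂ) * ((∑ ν ∈ Finset.range 13, (dF ν v) ^ 2) + (dInf v) ^ 2)
def Phi18 (v : Fin 6 → ℂ) : ℂ :=
  (1 / (13 * 6) : ℂ) * ((∑ ν ∈ Finset.range 13, (dF ν v) ^ 3) + (dInf v) ^ 3)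
def Phi30 (v : Fin 6 → ℂ) : ℂ :=
  -(1 / (13 * 1315) : ℂ) * ((∑ ν ∈ Finset.range 13, (dF ν v) ^ 5) + (dInf v) ^ 5)
def Phi42 (v : Fin 6 → ℂ) : ℂ :=
  (1 / (13 * 226842) : ℂ) * ((∑ ν ∈ Finset.range 13, (dF ν v) ^ 7) + (dInf v) ^ 7)

def Phi20 (v : Fin 6 → ℂ) : ℂ :=
  (1 / (13 * 25) : ℂ) * ((∑ ν ∈ Finset.range 13, (wF ν v) ^ 5) + (wInf v) ^ 5)
def Phi32 (v : Fin 6 → ℂ) : ℂ :=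
  -(1 / (13 * 1840) : ℂ) * ((∑ ν ∈ Finset.range 13, (wF ν v) ^ 8) + (wInf v) ^ 8)
def Phi44 (v : Fin 6 → ℂ) : ℂ :=
  (1 / (13 * 146905) : ℂ) * ((∑ ν ∈ Finset.range 13, (wF ν v) ^ 11) + (wInf v) ^ 11)

def th13 (c : ℚ) (k : ℤ) (z : ℂ) : ℂ :=
  Complex.exp (2 * Real.pi * Complex.I * (c : ℂ) * z) *
    ∑' n : ℤ, (-1 : ℂ) ^ n *
      Complex.exp (2 * Real.pi * Complex.I * (((13 * n ^ 2 + k * n : ℤ) : ℂ) / 2) * z)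

def ta : Fin 6 → ℂ → ℂ :=
  ![th13 (121 / 104) 11, th13 (49 / 104) 7, th13 (25 / 104) 5,
    fun z => -th13 (9 / 104) 3 z, th13 (81 / 104) 9, th13 (1 / 104) 1]

def AV (z : ℂ) : Fin 6 → ℂ := fun i => ta i z

def etaF (z : ℂ) : ℂ :=
  Complex.exp (2 * Real.pi * Complex.I * z / 24) *
    ∏' n : ℕ, (1 - Complex.exp (2 * Real.pi * Complex.I * z) ^ (n + 1))

def xV (z : ℂ) : Fin 6 → ℂ := fun i => etaF z * ta i z

def Δfun (z : ℂ) : ℂ := (etaF z) ^ 24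

def Eis (k : ℕ) (z : ℂ) : ℂ :=
  (1 / 2 : ℂ) * ∑' p : {p : ℤ × ℤ // Int.gcd p.1 p.2 = 1},
    1 / ((p.val.1 : ℂ) * z + (p.val.2 : ℂ)) ^ k

/-- The diagonal action of a thirteenth root of unity induced by `z ↦ z + 1`. -/
def rotate (w : ℂ) (v : Fin 6 → ℂ) : Fin 6 → ℂ :=
  ![w ^ 7 * v 0, w ^ 11 * v 1, w ^ 8 * v 2, w ^ 6 * v 3, w ^ 2 * v 4, w ^ 5 * v 5]

set_option maxHeartbeats 1000000 in
theorem DD_rotate {w : ℂ} (hw : w ^ 13 = 1) (v : Fin 6 → ℂ) :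
    DD0 (rotate w v) = DD0 v ∧
      DD1 (rotate w v) = w ^ 1 * DD1 v ∧
      DD2 (rotate w v) = w ^ 2 * DD2 v ∧
      DD3 (rotate w v) = w ^ 3 * DD3 v ∧
      DD4 (rotate w v) = w ^ 4 * DD4 v ∧
      DD5 (rotate w v) = w ^ 5 * DD5 v ∧
      DD6 (rotate w v) = w ^ 6 * DD6 v ∧
      DD7 (rotate w v) = w ^ 7 * DD7 v ∧
      DD8 (rotate w v) = w ^ 8 * DD8 v ∧
      DD9 (rotate w v) = w ^ 9 * DD9 v ∧
      DD10 (rotate w v) = w ^ 10 * DD10 v ∧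
      DD11 (rotate w v) = w ^ 11 * DD11 v ∧
      DD12 (rotate w v) = w ^ 12 * DD12 v ∧
      DDinf (rotate w v) = DDinf v := by
  refine ⟨?_, ?_, ?_, ?_, ?_, ?_, ?_, ?_, ?_, ?_, ?_, ?_, ?_, ?_⟩ <;>
    simp [DD0, DD1, DD2, DD3, DD4, DD5, DD6, DD7, DD8, DD9, DD10, DD11, DD12, DDinf,
      rotate] <;> grind

theorem GG_rotate {w : ℂ} (hw : w ^ 13 = 1) (v : Fin 6 → ℂ) :
    GG0 (rotate w v) = GG0 v ∧
      GG1 (rotate w v) = w ^ 1 * GG1 v ∧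
      GG2 (rotate w v) = w ^ 2 * GG2 v ∧
      GG3 (rotate w v) = w ^ 3 * GG3 v ∧
      GG4 (rotate w v) = w ^ 4 * GG4 v ∧
      GG5 (rotate w v) = w ^ 5 * GG5 v ∧
      GG6 (rotate w v) = w ^ 6 * GG6 v ∧
      GG7 (rotate w v) = w ^ 7 * GG7 v ∧
      GG8 (rotate w v) = w ^ 8 * GG8 v ∧
      GG9 (rotate w v) = w ^ 9 * GG9 v ∧
      GG10 (rotate w v) = w ^ 10 * GG10 v ∧
      GG11 (rotate w v) = w ^ 11 * GG11 v ∧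
      GG12 (rotate w v) = w ^ 12 * GG12 v := by
  obtain ⟨h0, h1, h2, h3, h4, h5, h6, h7, h8, h9, h10, h11, h12, hi⟩ := DD_rotate hw v
  refine ⟨?_, ?_, ?_, ?_, ?_, ?_, ?_, ?_, ?_, ?_, ?_, ?_, ?_⟩ <;>
    simp only [GG0, GG1, GG2, GG3, GG4, GG5, GG6, GG7, GG8, GG9, GG10, GG11, GG12, h0, h1, h2, h3,
      h4, h5, h6, h7, h8, h9, h10, h11, h12, hi] <;> grind

/-- The cubic covariant multiplying the first Gaussian period difference in `dft_oddExt_prod`. -/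
def cubicM (v : Fin 6 → ℂ) : ℂ :=
  2 * DD0 v + DD1 v + DD2 v + DD3 v - DD4 v + DD5 v + DD6 v + DD9 v - DD10 v - DD12 v - 3 * DDinf v

/-- The cubic covariant multiplying the second Gaussian period difference in `dft_oddExt_prod`. -/
def cubicN (v : Fin 6 → ℂ) : ℂ :=
  -3 * DD0 v + DD1 v + DD3 v + DD4 v + DD7 v + DD8 v + DD9 v + DD10 v + DD11 v + DD12 v - 2 *
    DDinf v

theorem cubicM_sq_add_cubicN_sq (v : Fin 6 → ℂ) : cubicM v ^ 2 + cubicN v ^ 2 = -dF 0 v := by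
  simp only [cubicM, cubicN, dF, GG0, GG1, GG2, GG3, GG4, GG5, GG6, GG7, GG8, GG9, GG10, GG11, GG12,
    Nat.mul_zero, pow_zero]
  ring

/-- The odd function on `ZMod 13` with values `v` at `1, 3, 9, 8, 11, 7`. -/
def oddExt (v : Fin 6 → ℂ) : ZMod 13 → ℂ :=
  ![0, v 0, -v 4, v 1, -v 2, -v 3, -v 5, v 5, v 3, v 2, -v 1, v 4, -v 0]

/-- Restriction of a function on `ZMod 13` to the points `1, 3, 9, 8, 11, 7`. -/
def sample (f : ZMod 13 → ℂ) : Fin 6 → ℂ := ![f 1, f 3, f 9, f 8, f 11, f 7]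

/-- The standard additive character of `ZMod 13`, normalised by `chi 1 = ζ`. -/
abbrev chi : AddChar (ZMod 13) ℂ := ZMod.stdAddChar

theorem chi_natCast (n : ℕ) : chi n = ζ ^ n := by
  have := ZMod.stdAddChar_coe (N := 13) n
  rw [ζ, ← Complex.exp_nat_mul]
  simp only [Int.cast_natCast, Nat.cast_ofNat] at this
  rw [chi, this]
  congr 1
  ring

theorem chi_mul (j c : ZMod 13) : chi (j * c) = chi c ^ j.val := by
  rw [← AddChar.map_nsmul_eq_pow, nsmul_eq_mul, ZMod.natCast_zmod_val]

theorem chi_pow_thirteen (c : ZMod 13) : chi c ^ 13 = 1 := by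
  rw [← AddChar.map_nsmul_eq_pow, nsmul_eq_mul]
  have : ((13 : ℕ) : ZMod 13) = 0 := rfl
  rw [this, zero_mul, AddChar.map_zero_eq_one]

theorem chi_geom_sum {c : ZMod 13} (hc : c ≠ 0) : ∑ i ∈ Finset.range 13, chi c ^ i = 0 := by
  have h1 : chi c ≠ 1 :=
    fun h => hc (ZMod.injective_stdAddChar (by rw [AddChar.map_zero_eq_one]; exact h))
  have h := mul_geom_sum (chi c) 13
  rw [chi_pow_thirteen, sub_self] at h
  exact (mul_eq_zero.mp h).resolve_left (sub_ne_zero.mpr h1)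

theorem dft_oddExt_mul (v : Fin 6 → ℂ) (j c : ZMod 13) :
    ZMod.dft (oddExt v) (j * c) = ∑ k, chi c ^ (-(k * j)).val * oddExt v k := by
  simp_rw [ZMod.dft_apply, smul_eq_mul, ← chi_mul, neg_mul, mul_assoc]

theorem sum_zmod_thirteen (g : ZMod 13 → ℂ) :
    ∑ k, g k = g 0 + g 1 + g 2 + g 3 + g 4 + g 5 + g 6 + g 7 + g 8 + g 9 + g 10 + g 11 + g 12 := by
  have h (g : Fin 13 → ℂ) :
      ∑ k, g k = g 0 + g 1 + g 2 + g 3 + g 4 + g 5 + g 6 + g 7 + g 8 + g 9 + g 10 + g 11 + g 12 := by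
    simp only [Fin.sum_univ_castSucc, Fin.sum_univ_zero, zero_add]
    rfl
  exact h g

set_option maxHeartbeats 4000000 in
theorem dft_oddExt_prod (v : Fin 6 → ℂ) {c : ZMod 13} (hc : c ≠ 0) :
    ZMod.dft (oddExt v) (1 * c) * ZMod.dft (oddExt v) (3 * c) * ZMod.dft (oddExt v) (9 * c) =
      (chi c + chi c ^ 3 + chi c ^ 9 - chi c ^ 4 - chi c ^ 10 - chi c ^ 12) * cubicM v +
      (chi c ^ 2 + chi c ^ 5 + chi c ^ 6 - chi c ^ 7 - chi c ^ 8 - chi c ^ 11) * cubicN v := by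
  have hz := chi_geom_sum hc
  simp only [dft_oddExt_mul, sum_zmod_thirteen, cubicM, cubicN]
  generalize chi c = z at *
  simp only [Finset.sum_range_succ, Finset.sum_range_zero] at hz
  simp only [DD0, DD1, DD2, DD3, DD4, DD5, DD6, DD7, DD8, DD9, DD10, DD11, DD12, DDinf]
  change (z ^ 0 * 0 + z ^ 12 * v 0 + z ^ 11 * (-v 4) + z ^ 10 * v 1 + z ^ 9 * (-v 2) + z ^ 8 *
    (-v 3) + z ^ 7 * (-v 5) + z ^ 6 * v 5 + z ^ 5 * v 3 + z ^ 4 * v 2 + z ^ 3 * (-v 1) + z ^ 2 *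
    v 4 + z ^ 1 * (-v 0)) *
    (z ^ 0 * 0 + z ^ 10 * v 0 + z ^ 7 * (-v 4) + z ^ 4 * v 1 + z ^ 1 * (-v 2) + z ^ 11 * (-v 3) +
      z ^ 8 * (-v 5) + z ^ 5 * v 5 + z ^ 2 * v 3 + z ^ 12 * v 2 + z ^ 9 * (-v 1) + z ^ 6 * v 4 +
      z ^ 3 * (-v 0)) *
    (z ^ 0 * 0 + z ^ 4 * v 0 + z ^ 8 * (-v 4) + z ^ 12 * v 1 + z ^ 3 * (-v 2) + z ^ 7 * (-v 3) +
      z ^ 11 * (-v 5) + z ^ 2 * v 5 + z ^ 6 * v 3 + z ^ 10 * v 2 + z ^ 1 * (-v 1) + z ^ 5 * v 4 +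
      z ^ 9 * (-v 0)) = _
  linear_combination (v 0^3*(z^2 - z^3 + z^5 - 2*z^7 + z^8 - z^11 + z^12 - z^13 + z^14 +
    z^18 - z^19) + v 0^2*v 1*(-z^1 + 2*z^2 - 2*z^3 + 2*z^4 - z^5 + z^6 - 2*z^7 - z^9 +
    4*z^10 - 3*z^11 + 3*z^12 - 2*z^13 + z^14 - z^15 + z^16 - 2*z^17 + z^18 - z^21 + z^22) +
    v 0^2*v 2*(-2*z^1 + 4*z^4 - 4*z^5 + z^6 + 2*z^7 + z^8 - 4*z^9 + 4*z^10 - 2*z^11 +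
    2*z^12 - 2*z^13 - 2*z^15 + 2*z^16 - z^19 + 2*z^20 - z^21) + v 0^2*v 3*(-2*z^2 + 2*z^3 - 2*z^5 +
    3*z^7 + z^8 - 2*z^9 + z^10 - z^12 - z^15 + 2*z^16 - z^17 - z^19 + z^20) + v 0^2*v 5*(-z^1 +
    z^2 - z^3 + 2*z^4 - z^5 + z^6 - z^7 - z^9 + z^10 + z^12 - 2*z^13 + z^14 - z^16 + z^17 +
    z^20 - z^21) + v 0^2*v 4*(-z^1 + 2*z^4 - 2*z^5 + 2*z^7 - 2*z^9 + 2*z^10 - z^11 +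
    z^12 - z^13 - z^15 + z^16) + v 0*v 1^2*(-2*z^1 + 4*z^4 - 4*z^5 + z^6 + 2*z^7 + z^8 - 4*z^9 +
    4*z^10 - 2*z^11 + 2*z^12 - 2*z^13 - 2*z^15 + 2*z^16 - z^19 + 2*z^20 - z^21) +
    v 0*v 1*v 2*(-2*z^1 + 5*z^2 - 6*z^3 + 5*z^4 + z^5 - 6*z^7 + 3*z^8 - 3*z^9 + 5*z^10 - 5*z^11 +
    6*z^12 - 6*z^13 + 4*z^14 - z^15 - z^17 + 4*z^18 - 3*z^19 - z^23 + z^24) +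
    v 0*v 1*v 3*(z^2 - z^3 + z^4 - 2*z^7 + z^9 - 2*z^11 + 3*z^12 - 2*z^13 + 2*z^14 - 2*z^15 + z^16 +
    z^22 - z^23) + v 0*v 1*v 4*(3*z^2 - 3*z^3 + 3*z^5 + z^6 - 7*z^7 + z^8 + z^9 + z^10 - 2*z^11 +
    2*z^12 - z^13 + z^14 + z^15 - z^16 - z^17 + 2*z^18 - z^19 + z^20 - z^21) + v 0*v 1*v 5*(-z^1 +
    2*z^2 - 2*z^3 + 2*z^4 - 2*z^7 + z^8 - z^9 + 2*z^10 - 3*z^11 + 3*z^12 - z^13 - z^15 + z^16 +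
    z^18 - z^19) + v 0*v 2^2*(-z^1 + 2*z^2 - 2*z^3 + 2*z^4 - z^5 + z^6 - 2*z^7 - z^9 +
    4*z^10 - 3*z^11 + 3*z^12 - 2*z^13 + z^14 - z^15 + z^16 - 2*z^17 + z^18 - z^21 + z^22) +
    v 0*v 2*v 3*(3*z^2 - 3*z^3 + 3*z^5 + z^6 - 7*z^7 + z^8 + z^9 + z^10 - 2*z^11 + 2*z^12 - z^13 +
    z^14 + z^15 - z^16 - z^17 + 2*z^18 - z^19 + z^20 - z^21) + v 0*v 2*v 5*(z^2 - z^3 +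
    z^4 - 2*z^7 + z^9 - 2*z^11 + 3*z^12 - 2*z^13 + 2*z^14 - 2*z^15 + z^16 + z^22 - z^23) +
    v 0*v 3*v 4*(-z^1 + z^2 - z^3 + 2*z^4 - z^5 - z^9 + 2*z^10 - z^11 + 2*z^12 - 5*z^13 +
    4*z^14 - z^15) + v 0*v 3*v 5*(-3*z^1 + 3*z^2 - 3*z^3 + 6*z^4 - 4*z^5 + z^6 - 3*z^9 +
    5*z^10 - 2*z^11 + 3*z^12 - 2*z^13 - z^14 - z^16 + z^17 - z^21 + z^22) +
    v 0*v 3^2*(2*z^1 - 2*z^2 + 2*z^3 - 4*z^4 + 2*z^5 + z^9 - 2*z^10 + 2*z^11 - 3*z^12 + 2*z^13 +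
    z^15 - 2*z^17 + z^18) + v 0*v 2*v 4*(-z^1 + 2*z^2 - 2*z^3 + 2*z^4 - 2*z^7 + z^8 - z^9 +
    2*z^10 - 3*z^11 + 3*z^12 - z^13 - z^15 + z^16 + z^18 - z^19) + v 0*v 4^2*(-z^2 + z^3 - z^5 +
    2*z^7 - z^9 - z^10 + 2*z^11 - z^12 + z^13 - z^14 - z^16 + z^17) + v 0*v 4*v 5*(-z^1 +
    2*z^4 - 2*z^5 + z^7 + z^8 - 3*z^9 + 4*z^10 - z^11 - z^13 + z^16 - 2*z^17 + z^18 - z^19 + z^20) +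
    v 0*v 5^2*(z^1 - 2*z^2 + 2*z^3 - 2*z^4 + 2*z^7 - z^8 + z^9 - 2*z^10 + 2*z^11 - z^12 +
    z^14 - z^15 - z^18 + z^19) + v 1^3*(z^2 - z^3 + z^5 - 2*z^7 + z^8 - z^11 + z^12 - z^13 + z^14 +
    z^18 - z^19) + v 1^2*v 2*(-z^1 + 2*z^2 - 2*z^3 + 2*z^4 - z^5 + z^6 - 2*z^7 - z^9 +
    4*z^10 - 3*z^11 + 3*z^12 - 2*z^13 + z^14 - z^15 + z^16 - 2*z^17 + z^18 - z^21 + z^22) +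
    v 1^2*v 3*(-z^1 + z^2 - z^3 + 2*z^4 - z^5 + z^6 - z^7 - z^9 + z^10 + z^12 - 2*z^13 +
    z^14 - z^16 + z^17 + z^20 - z^21) + v 1^2*v 4*(-2*z^2 + 2*z^3 - 2*z^5 + 3*z^7 + z^8 - 2*z^9 +
    z^10 - z^12 - z^15 + 2*z^16 - z^17 - z^19 + z^20) + v 1^2*v 5*(-z^1 + 2*z^4 - 2*z^5 +
    2*z^7 - 2*z^9 + 2*z^10 - z^11 + z^12 - z^13 - z^15 + z^16) + v 1*v 2^2*(-2*z^1 + 4*z^4 - 4*z^5 +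
    z^6 + 2*z^7 + z^8 - 4*z^9 + 4*z^10 - 2*z^11 + 2*z^12 - 2*z^13 - 2*z^15 + 2*z^16 - z^19 +
    2*z^20 - z^21) + v 1*v 2*v 3*(-z^1 + 2*z^2 - 2*z^3 + 2*z^4 - 2*z^7 + z^8 - z^9 +
    2*z^10 - 3*z^11 + 3*z^12 - z^13 - z^15 + z^16 + z^18 - z^19) + v 1*v 2*v 4*(z^2 - z^3 +
    z^4 - 2*z^7 + z^9 - 2*z^11 + 3*z^12 - 2*z^13 + 2*z^14 - 2*z^15 + z^16 + z^22 - z^23) +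
    v 1*v 2*v 5*(3*z^2 - 3*z^3 + 3*z^5 + z^6 - 7*z^7 + z^8 + z^9 + z^10 - 2*z^11 + 2*z^12 - z^13 +
    z^14 + z^15 - z^16 - z^17 + 2*z^18 - z^19 + z^20 - z^21) + v 1*v 3^2*(z^1 - 2*z^2 +
    2*z^3 - 2*z^4 + 2*z^7 - z^8 + z^9 - 2*z^10 + 2*z^11 - z^12 + z^14 - z^15 - z^18 + z^19) +
    v 1*v 3*v 4*(-3*z^1 + 3*z^2 - 3*z^3 + 6*z^4 - 4*z^5 + z^6 - 3*z^9 + 5*z^10 - 2*z^11 +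
    3*z^12 - 2*z^13 - z^14 - z^16 + z^17 - z^21 + z^22) + v 1*v 3*v 5*(-z^1 + 2*z^4 - 2*z^5 + z^7 +
    z^8 - 3*z^9 + 4*z^10 - z^11 - z^13 + z^16 - 2*z^17 + z^18 - z^19 + z^20) +
    v 1*v 4^2*(2*z^1 - 2*z^2 + 2*z^3 - 4*z^4 + 2*z^5 + z^9 - 2*z^10 + 2*z^11 - 3*z^12 + 2*z^13 +
    z^15 - 2*z^17 + z^18) + v 1*v 4*v 5*(-z^1 + z^2 - z^3 + 2*z^4 - z^5 - z^9 + 2*z^10 - z^11 +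
    2*z^12 - 5*z^13 + 4*z^14 - z^15) + v 1*v 5^2*(-z^2 + z^3 - z^5 + 2*z^7 - z^9 - z^10 +
    2*z^11 - z^12 + z^13 - z^14 - z^16 + z^17) + v 2^3*(z^2 - z^3 + z^5 - 2*z^7 + z^8 - z^11 +
    z^12 - z^13 + z^14 + z^18 - z^19) + v 2^2*v 3*(-z^1 + 2*z^4 - 2*z^5 + 2*z^7 - 2*z^9 +
    2*z^10 - z^11 + z^12 - z^13 - z^15 + z^16) + v 2^2*v 5*(-2*z^2 + 2*z^3 - 2*z^5 + 3*z^7 +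
    z^8 - 2*z^9 + z^10 - z^12 - z^15 + 2*z^16 - z^17 - z^19 + z^20) + v 2^2*v 4*(-z^1 + z^2 - z^3 +
    2*z^4 - z^5 + z^6 - z^7 - z^9 + z^10 + z^12 - 2*z^13 + z^14 - z^16 + z^17 + z^20 - z^21) +
    v 2*v 3^2*(-z^2 + z^3 - z^5 + 2*z^7 - z^9 - z^10 + 2*z^11 - z^12 + z^13 - z^14 - z^16 + z^17) +
    v 2*v 3*v 4*(-z^1 + 2*z^4 - 2*z^5 + z^7 + z^8 - 3*z^9 + 4*z^10 - z^11 - z^13 + z^16 - 2*z^17 +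
    z^18 - z^19 + z^20) + v 2*v 3*v 5*(-z^1 + z^2 - z^3 + 2*z^4 - z^5 - z^9 + 2*z^10 - z^11 +
    2*z^12 - 5*z^13 + 4*z^14 - z^15) + v 2*v 4^2*(z^1 - 2*z^2 + 2*z^3 - 2*z^4 + 2*z^7 - z^8 +
    z^9 - 2*z^10 + 2*z^11 - z^12 + z^14 - z^15 - z^18 + z^19) + v 2*v 4*v 5*(-3*z^1 +
    3*z^2 - 3*z^3 + 6*z^4 - 4*z^5 + z^6 - 3*z^9 + 5*z^10 - 2*z^11 + 3*z^12 - 2*z^13 - z^14 - z^16 +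
    z^17 - z^21 + z^22) + v 2*v 5^2*(2*z^1 - 2*z^2 + 2*z^3 - 4*z^4 + 2*z^5 + z^9 - 2*z^10 +
    2*z^11 - 3*z^12 + 2*z^13 + z^15 - 2*z^17 + z^18) + v 3^3*(z^1 - z^2 + z^3 - 2*z^4 + z^5 +
    z^9 - 2*z^10 + z^11 - z^12 + 2*z^13 - z^14) + v 3^2*v 4*(z^1 - 2*z^4 + 2*z^5 - 2*z^7 +
    2*z^9 - z^10 - 2*z^11 + 2*z^12 + z^14 - 2*z^15 + 2*z^16 - z^17) + v 3^2*v 5*(-2*z^1 +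
    4*z^2 - 4*z^3 + 4*z^4 - 4*z^7 + z^9 + 3*z^10 - 4*z^11 + 3*z^12 - z^13 - z^14 + z^15 +
    z^17 - z^18) + v 3*v 4^2*(-2*z^1 + 4*z^2 - 4*z^3 + 4*z^4 - 4*z^7 + z^9 + 3*z^10 - 4*z^11 +
    3*z^12 - z^13 - z^14 + z^15 + z^17 - z^18) + v 3*v 4*v 5*(3*z^1 - z^2 + z^3 - 6*z^4 + 5*z^5 +
    z^6 - 5*z^7 + 5*z^9 - 6*z^10 + z^11 - z^12 + 6*z^13 - 3*z^14 + z^20 - z^21) +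
    v 3*v 5^2*(z^1 - 2*z^4 + 2*z^5 - 2*z^7 + 2*z^9 - z^10 - 2*z^11 + 2*z^12 + z^14 - 2*z^15 +
    2*z^16 - z^17) + v 4^3*(z^1 - z^2 + z^3 - 2*z^4 + z^5 + z^9 - 2*z^10 + z^11 - z^12 +
    2*z^13 - z^14) + v 4^2*v 5*(z^1 - 2*z^4 + 2*z^5 - 2*z^7 + 2*z^9 - z^10 - 2*z^11 + 2*z^12 +
    z^14 - 2*z^15 + 2*z^16 - z^17) + v 4*v 5^2*(-2*z^1 + 4*z^2 - 4*z^3 + 4*z^4 - 4*z^7 + z^9 +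
    3*z^10 - 4*z^11 + 3*z^12 - z^13 - z^14 + z^15 + z^17 - z^18) + v 5^3*(z^1 - z^2 + z^3 - 2*z^4 +
    z^5 + z^9 - 2*z^10 + z^11 - z^12 + 2*z^13 - z^14)) * hz

theorem quadratic_periods {z : ℂ} (hz : ∑ i ∈ Finset.range 13, z ^ i = 0) :
    (z + z ^ 3 + z ^ 9 - z ^ 4 - z ^ 10 - z ^ 12) ^ 2 +
      (z ^ 2 + z ^ 5 + z ^ 6 - z ^ 7 - z ^ 8 - z ^ 11) ^ 2 = -13 := by
  simp only [Finset.sum_range_succ, Finset.sum_range_zero] at hz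
  linear_combination (13 - 13 * z + z ^ 2 - z ^ 3 + 3 * z ^ 4 - 5 * z ^ 5 + 3 * z ^ 6 - z ^ 7 +
    3 * z ^ 8 - 5 * z ^ 9 + 3 * z ^ 10 - z ^ 11 + z ^ 12) * hz

theorem mul_sample_dft (v : Fin 6 → ℂ) : GG0 (sample (ZMod.dft (oddExt v))) = 13 * dF 0 v := by
  have h1 := dft_oddExt_prod v (c := 1) (by decide)
  have h8 := dft_oddExt_prod v (c := 8) (by decide)
  have key := quadratic_periods (chi_geom_sum (c := 1) (by decide))
  have h13 := chi_pow_thirteen 1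
  have h18 : chi 8 = chi 1 ^ 8 := chi_mul 8 1 ▸ rfl
  have e : GG0 (sample (ZMod.dft (oddExt v))) =
      (ZMod.dft (oddExt v) (1 * 1) * ZMod.dft (oddExt v) (3 * 1) * ZMod.dft (oddExt v) (9 *
        1)) ^ 2 +
      (ZMod.dft (oddExt v) (1 * 8) * ZMod.dft (oddExt v) (3 * 8) * ZMod.dft (oddExt v) (9 *
        8)) ^ 2 :=
    rfl
  rw [e, h1, h8, h18]
  have hMN := cubicM_sq_add_cubicN_sq v
  clear e h1 h8 h18
  generalize chi 1 = z at *
  simp only [← pow_mul]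
  rw [pow_eq_pow_mod (8 * 3) h13, pow_eq_pow_mod (8 * 9) h13, pow_eq_pow_mod (8 * 4) h13,
    pow_eq_pow_mod (8 * 10) h13, pow_eq_pow_mod (8 * 12) h13, pow_eq_pow_mod (8 * 2) h13,
    pow_eq_pow_mod (8 * 5) h13, pow_eq_pow_mod (8 * 6) h13, pow_eq_pow_mod (8 * 7) h13,
    pow_eq_pow_mod (8 * 8) h13, pow_eq_pow_mod (8 * 11) h13]
  norm_num only
  linear_combination (cubicM v ^ 2 + cubicN v ^ 2) * key - 13 * hMN

/-- Multiplication by the quadratic exponential `j ↦ exp (2πi μ j² / 26)` on `ZMod 13`. -/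
def tw (μ : ZMod 13) (f : ZMod 13 → ℂ) (j : ZMod 13) : ℂ := chi (7 * μ * j ^ 2) * f j

theorem tw_odd {f : ZMod 13 → ℂ} (hf : Function.Odd f) (μ : ZMod 13) : Function.Odd (tw μ f) := by
  intro j
  simp only [tw, hf j, neg_sq, mul_neg]

theorem tw_zero (f : ZMod 13 → ℂ) : tw 0 f = f := by
  funext j
  simp [tw]

theorem oddExt_sample {f : ZMod 13 → ℂ} (hf : Function.Odd f) : oddExt (sample f) = f := by
  funext j
  have h0 : f 0 = 0 := by
    have := hf 0
    rw [neg_zero] at this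
    linear_combination this / 2
  fin_cases j
  · exact h0.symm
  · rfl
  · exact (hf 11).symm
  · rfl
  · exact (hf 9).symm
  · exact (hf 8).symm
  · exact (hf 7).symm
  all_goals first | rfl | exact (hf 3).symm | exact (hf 1).symm

theorem rotate_sample (μ : ZMod 13) (f : ZMod 13 → ℂ) :
    rotate (chi μ) (sample f) = sample (tw μ f) := by
  have h (j a : ZMod 13) (ha : 7 * j ^ 2 = a) : chi (7 * μ * j ^ 2) = chi μ ^ a.val := by
    rw [← chi_mul, ← ha]
    ring_nf
  funext i
  simp only [rotate, sample, tw]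
  rw [h 1 7 rfl, h 3 11 rfl, h 9 8 rfl, h 8 6 rfl, h 11 2 rfl, h 7 5 rfl]
  fin_cases i <;> rfl

theorem dF_val (μ : ZMod 13) (v : Fin 6 → ℂ) :
    dF μ.val v = -13 * GG0 v + chi μ * GG1 v + chi μ ^ 2 * GG2 v + chi μ ^ 3 * GG3 v +
      chi μ ^ 4 * GG4 v + chi μ ^ 5 * GG5 v + chi μ ^ 6 * GG6 v + chi μ ^ 7 * GG7 v +
      chi μ ^ 8 * GG8 v + chi μ ^ 9 * GG9 v + chi μ ^ 10 * GG10 v + chi μ ^ 11 * GG11 v +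
      chi μ ^ 12 * GG12 v := by
  have h : chi μ = ζ ^ μ.val := by rw [← chi_natCast, ZMod.natCast_zmod_val]
  rw [h, dF]
  simp only [← pow_mul, mul_comm _ μ.val]

theorem dF_rotate (ν μ : ZMod 13) (v : Fin 6 → ℂ) :
    dF ν.val (rotate (chi μ) v) = dF (ν + μ).val v := by
  obtain ⟨h0, h1, h2, h3, h4, h5, h6, h7, h8, h9, h10, h11, h12⟩ :=
    GG_rotate (chi_pow_thirteen μ) v
  rw [dF_val, dF_val, AddChar.map_add_eq_mul, h0, h1, h2, h3, h4, h5, h6, h7, h8, h9, h10, h11, h12]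
  ring

theorem GG0_sample_dft_tw {f : ZMod 13 → ℂ} (hf : Function.Odd f) (μ : ZMod 13) :
    GG0 (sample (ZMod.dft (tw μ f))) = 13 * dF μ.val (sample f) := by
  have h := mul_sample_dft (sample (tw μ f))
  rw [oddExt_sample (tw_odd hf μ), ← rotate_sample] at h
  rw [h, ← zero_add μ, ← dF_rotate, zero_add]
  rfl

theorem GG0_sample_tw (μ : ZMod 13) (f : ZMod 13 → ℂ) : GG0 (sample (tw μ f)) = GG0 (sample f) := by
  rw [← rotate_sample, (GG_rotate (chi_pow_thirteen μ) _).1]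

theorem GG0_sample_const_mul (c : ℂ) (f : ZMod 13 → ℂ) :
    GG0 (sample (fun j => c * f j)) = c ^ 6 * GG0 (sample f) := by
  change (c * f 1 * (c * f 3) * (c * f 9)) ^ 2 + (c * f 8 * (c * f 11) * (c * f 7)) ^ 2 =
    c ^ 6 * ((f 1 * f 3 * f 9) ^ 2 + (f 8 * f 11 * f 7) ^ 2)
  ring

theorem GG0_sample_dilate {f : ZMod 13 → ℂ} (hf : Function.Odd f) {d : ZMod 13} (hd : d ≠ 0) :
    GG0 (sample (fun j => f (d * j))) = GG0 (sample f) := by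
  have h2 : f 2 = -f 11 := hf 11
  have h4 : f 4 = -f 9 := hf 9
  have h5 : f 5 = -f 8 := hf 8
  have h6 : f 6 = -f 7 := hf 7
  have h10 : f 10 = -f 3 := hf 3
  have h12 : f 12 = -f 1 := hf 1
  have e (a b c x y z : ZMod 13) (ha : d * 1 = a) (hb : d * 3 = b) (hc : d * 9 = c)
      (hx : d * 8 = x) (hy : d * 11 = y) (hz : d * 7 = z) :
      GG0 (sample (fun j => f (d * j))) = (f a * f b * f c) ^ 2 + (f x * f y * f z) ^ 2 := by
    rw [← ha, ← hb, ← hc, ← hx, ← hy, ← hz]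
    rfl
  have e' : GG0 (sample f) = (f 1 * f 3 * f 9) ^ 2 + (f 8 * f 11 * f 7) ^ 2 := rfl
  rw [e']
  fin_cases d
  · exact absurd rfl hd
  · rw [e 1 3 9 8 11 7 rfl rfl rfl rfl rfl rfl]
  · rw [e 2 6 5 3 9 1 rfl rfl rfl rfl rfl rfl, h2, h6, h5]; ring
  · rw [e 3 9 1 11 7 8 rfl rfl rfl rfl rfl rfl]; ring
  · rw [e 4 12 10 6 5 2 rfl rfl rfl rfl rfl rfl, h4, h12, h10, h6, h5, h2]; ring
  · rw [e 5 2 6 1 3 9 rfl rfl rfl rfl rfl rfl, h2, h6, h5]; ring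
  · rw [e 6 5 2 9 1 3 rfl rfl rfl rfl rfl rfl, h2, h6, h5]; ring
  · rw [e 7 8 11 4 12 10 rfl rfl rfl rfl rfl rfl, h4, h12, h10]; ring
  · rw [e 8 11 7 12 10 4 rfl rfl rfl rfl rfl rfl, h4, h12, h10]; ring
  · rw [e 9 1 3 7 8 11 rfl rfl rfl rfl rfl rfl]; ring
  · rw [e 10 4 12 2 6 5 rfl rfl rfl rfl rfl rfl, h4, h12, h10, h6, h5, h2]; ring
  · rw [e 11 7 8 10 4 12 rfl rfl rfl rfl rfl rfl, h4, h12, h10]; ring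
  · rw [e 12 10 4 5 2 6 rfl rfl rfl rfl rfl rfl, h4, h12, h10, h6, h5, h2]; ring

/-- The quadratic Gauss sum over `ZMod 13`. -/
def quadGauss (a : ZMod 13) : ℂ := ∑ k, chi (a * k ^ 2)

theorem quadGauss_sq {a : ZMod 13} (ha : a ≠ 0) : quadGauss a ^ 2 = 13 := by
  have hz := chi_geom_sum ha
  have h (k : ZMod 13) : chi (a * k ^ 2) = chi a ^ (k ^ 2).val := by rw [← chi_mul, mul_comm]
  simp only [quadGauss, h, sum_zmod_thirteen]
  generalize chi a = z at *
  simp only [Finset.sum_range_succ, Finset.sum_range_zero] at hz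
  change (z ^ 0 + z ^ 1 + z ^ 4 + z ^ 9 + z ^ 3 + z ^ 12 + z ^ 10 + z ^ 10 + z ^ 12 + z ^ 3 +
    z ^ 9 + z ^ 4 + z ^ 1) ^ 2 = 13
  linear_combination (- 12 * z ^ 0 + 16 * z ^ 1 + 8 * z ^ 4 - 4 * z ^ 5 - 4 * z ^ 6 + 4 *
    z ^ 7 - 4 * z ^ 8 + 8 * z ^ 10 - 4 * z ^ 11 + 4 * z ^ 12) * hz

theorem dft_tw_dft (f : ZMod 13 → ℂ) {ν : ZMod 13} (hν : ν ≠ 0) :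
    ZMod.dft (tw ν (ZMod.dft f)) = fun j => quadGauss (7 * ν) *
      tw (-ν⁻¹) (fun j => ZMod.dft (tw (-ν⁻¹) f) (ν⁻¹ * j)) j := by
  have : Fact (Nat.Prime 13) := ⟨by norm_num⟩
  funext j
  have h13 : (13 : ZMod 13) = 0 := rfl
  have gauss (l : ZMod 13) : ∑ k, chi (-(k * j)) * (chi (7 * ν * k ^ 2) * chi (-(l * k))) =
      quadGauss (7 * ν) * (chi (7 * -ν⁻¹ * j ^ 2) * (chi (-(l * (ν⁻¹ * j))) *
        chi (7 * -ν⁻¹ * l ^ 2))) := by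
    rw [quadGauss, ← Equiv.sum_comp (Equiv.addRight (ν⁻¹ * (j + l))), Finset.sum_mul]
    refine Finset.sum_congr rfl fun k _ => ?_
    simp only [← AddChar.map_add_eq_mul, Equiv.coe_addRight]
    congr 1
    have hi : ν * ν⁻¹ = 1 := mul_inv_cancel₀ hν
    linear_combination (14 * k * (j + l) + 7 * ν⁻¹ * (j + l) ^ 2) * hi +
      (k * (j + l) + ν⁻¹ * (j ^ 2 + j * l + l ^ 2)) * h13
  simp only [ZMod.dft_apply, smul_eq_mul, tw, Finset.mul_sum]
  rw [Finset.sum_comm]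
  refine Finset.sum_congr rfl fun l _ => ?_
  have h := congrArg (· * f l) (gauss l)
  simp only [Finset.sum_mul] at h
  calc _ = _ := Finset.sum_congr rfl fun k _ => by ring
    _ = _ := h
    _ = _ := by ring

theorem dF_sample_dft {f : ZMod 13 → ℂ} (hf : Function.Odd f) {ν : ZMod 13} (hν : ν ≠ 0) :
    dF ν.val (sample (ZMod.dft f)) = 13 ^ 3 * dF (-ν⁻¹).val (sample f) := by
  have h7 : (7 : ZMod 13) ≠ 0 := by decide
  have : Fact (Nat.Prime 13) := ⟨by norm_num⟩
  have h := GG0_sample_dft_tw (ZMod.dft_odd_iff.mpr hf) ν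
  rw [dft_tw_dft f hν, GG0_sample_const_mul, GG0_sample_tw,
    GG0_sample_dilate (ZMod.dft_odd_iff.mpr (tw_odd hf _)) (inv_ne_zero hν), GG0_sample_dft_tw hf,
    show quadGauss (7 * ν) ^ 6 = (quadGauss (7 * ν) ^ 2) ^ 3 by ring,
    quadGauss_sq (mul_ne_zero h7 hν)] at h
  linear_combination -h / 13

theorem dInf_sample_dft {f : ZMod 13 → ℂ} (hf : Function.Odd f) :
    dInf (sample (ZMod.dft f)) = 13 ^ 3 * dF 0 (sample f) := by
  have h := GG0_sample_dft_tw hf 0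
  rw [tw_zero, ZMod.val_zero] at h
  rw [dInf, h]
  ring

theorem dF_zero_sample_dft {f : ZMod 13 → ℂ} (hf : Function.Odd f) :
    dF 0 (sample (ZMod.dft f)) = 13 ^ 3 * dInf (sample f) := by
  have h := GG0_sample_dft_tw (ZMod.dft_odd_iff.mpr hf) 0
  have h' : ZMod.dft (ZMod.dft f) = fun j => (-13 : ℂ) * f j := by
    rw [ZMod.dft_dft]
    funext j
    simp [hf j]
  rw [tw_zero, ZMod.val_zero, h', GG0_sample_const_mul] at h
  rw [dInf]
  linear_combination -h / 13

theorem Phi18_eq_sum_zmod (v : Fin 6 → ℂ) :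
    Phi18 v = 1 / 78 * (∑ ν : ZMod 13, dF ν.val v ^ 3 + dInf v ^ 3) := by
  rw [Phi18, Finset.sum_range]
  norm_num
  rfl

theorem Phi18_sample_dft {f : ZMod 13 → ℂ} (hf : Function.Odd f) :
    Phi18 (sample (ZMod.dft f)) = 13 ^ 9 * Phi18 (sample f) := by
  have : Fact (Nat.Prime 13) := ⟨by norm_num⟩
  have hinv : Function.Involutive fun ν : ZMod 13 => -ν⁻¹ := fun ν => by simp [inv_neg]
  rw [Phi18_eq_sum_zmod, Phi18_eq_sum_zmod, dInf_sample_dft hf,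
    ← Equiv.sum_comp hinv.toPerm (fun ν => dF ν.val (sample f) ^ 3),
    ← Finset.add_sum_erase _ _ (Finset.mem_univ 0), ← Finset.add_sum_erase _ _ (Finset.mem_univ 0),
    Finset.sum_congr rfl fun ν hν => by rw [dF_sample_dft hf (Finset.ne_of_mem_erase hν), mul_pow],
    ← Finset.mul_sum]
  simp only [Function.Involutive.coe_toPerm, inv_zero, neg_zero, ZMod.val_zero,
    dF_zero_sample_dft hf]
  ring

theorem Phi18_rotate (μ : ZMod 13) (v : Fin 6 → ℂ) : Phi18 (rotate (chi μ) v) = Phi18 v := by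
  simp only [Phi18_eq_sum_zmod, dF_rotate, dInf, (GG_rotate (chi_pow_thirteen μ) v).1]
  rw [← Equiv.sum_comp (Equiv.addRight μ) (fun ν => dF ν.val v ^ 3)]
  rfl

theorem Phi18_smul (c : ℂ) (v : Fin 6 → ℂ) : Phi18 (fun i => c * v i) = c ^ 18 * Phi18 v := by
  have hd (ν : ℕ) : dF ν (fun i => c * v i) = c ^ 6 * dF ν v := by
    simp only [dF, GG0, GG1, GG2, GG3, GG4, GG5, GG6, GG7, GG8, GG9, GG10, GG11, GG12, DD0, DD1,
      DD2, DD3, DD4, DD5, DD6, DD7, DD8, DD9, DD10, DD11, DD12, DDinf]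
    ring
  have hi : dInf (fun i => c * v i) = c ^ 6 * dInf v := by
    simp only [dInf, GG0, DD0, DDinf]
    ring
  simp only [Phi18, hd, hi, mul_pow, ← Finset.mul_sum]
  ring

/-- The theta series `∑ (-1)^m exp (πi (2m + 13)² z / 52)` over `m ≡ u mod 13`. -/
def thetaZ (z : ℂ) (u : ℤ) : ℂ :=
  (-1) ^ u * cexp (Real.pi * I * (2 * u + 13) ^ 2 * z / 52) *
    jacobiTheta₂ (1 / 2 + (2 * u + 13) * z / 2) (13 * z)

/-- The theta vector of order thirteen as a function on `ZMod 13`. -/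
def thetaMod (z : ℂ) (u : ZMod 13) : ℂ := thetaZ z u.val

theorem thetaZ_add_thirteen (z : ℂ) (u : ℤ) : thetaZ z (u + 13) = thetaZ z u := by
  have h := jacobiTheta₂_add_left' (1 / 2 + (2 * u + 13) * z / 2) (13 * z)
  rw [thetaZ, thetaZ, show (1 / 2 + (2 * ((u + 13 : ℤ) : ℂ) + 13) * z / 2) =
    1 / 2 + (2 * u + 13) * z / 2 + 13 * z by push_cast; ring, h]
  have e : cexp (Real.pi * I * (2 * ((u + 13 : ℤ) : ℂ) + 13) ^ 2 * z / 52) *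
      cexp (-Real.pi * I * (13 * z + 2 * (1 / 2 + (2 * u + 13) * z / 2))) =
      -cexp (Real.pi * I * (2 * u + 13) ^ 2 * z / 52) := by
    rw [← Complex.exp_add, ← neg_one_mul (cexp _), ← Complex.exp_neg_pi_mul_I, ← Complex.exp_add]
    congr 1
    push_cast
    ring
  have e' : (-1 : ℂ) ^ (u + 13) = -(-1) ^ u := by
    rw [zpow_add₀ (by norm_num)]
    norm_num
  rw [e', ← mul_assoc, mul_assoc (-(-1) ^ u), e]
  ring

theorem thetaZ_neg_sub (z : ℂ) (u : ℤ) : thetaZ z (-u - 13) = -thetaZ z u := by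
  have h : jacobiTheta₂ (1 / 2 + (2 * ((-u - 13 : ℤ) : ℂ) + 13) * z / 2) (13 * z) =
      jacobiTheta₂ (1 / 2 + (2 * u + 13) * z / 2) (13 * z) := by
    rw [← jacobiTheta₂_neg_left, ← jacobiTheta₂_add_left]
    congr 1
    push_cast
    ring
  have e' : (-1 : ℂ) ^ (-u - 13) = -(-1) ^ u := by
    rw [zpow_sub₀ (by norm_num), zpow_neg, ← inv_zpow]
    norm_num [div_neg]
  rw [thetaZ, thetaZ, h, e']
  push_cast
  ring_nf

theorem thetaMod_intCast (z : ℂ) (u : ℤ) : thetaMod z u = thetaZ z u := by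
  have h : Function.Periodic (thetaZ z) 13 := thetaZ_add_thirteen z
  rw [thetaMod, ZMod.val_intCast]
  rw [Int.emod_def, mul_comm]
  exact h.sub_int_mul_eq (u / 13)

theorem thetaMod_odd (z : ℂ) : Function.Odd (thetaMod z) := by
  intro u
  have h : ((u.val : ℤ) : ZMod 13) = u := by simp
  have h13 : ((13 : ℤ) : ZMod 13) = 0 := rfl
  rw [← h, thetaMod_intCast, ← thetaZ_neg_sub, ← thetaMod_intCast]
  push_cast
  have h13 : (13 : ZMod 13) = 0 := rfl
  rw [h13, sub_zero]

theorem th13_eq (k : ℤ) (z : ℂ) :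
    th13 ((k : ℚ) ^ 2 / 104) k z =
      cexp (Real.pi * I * k ^ 2 * z / 52) * jacobiTheta₂ (1 / 2 + k * z / 2) (13 * z) := by
  rw [th13, jacobiTheta₂]
  congr 1
  · push_cast
    ring_nf
  · refine tsum_congr fun n => ?_
    have h : (-1 : ℂ) ^ n = cexp (n * (Real.pi * I)) := by
      rw [Complex.exp_int_mul, Complex.exp_pi_mul_I]
    rw [jacobiTheta₂_term, h, ← Complex.exp_add]
    congr 1
    push_cast
    ring

theorem AV_eq_sample (z : ℂ) : AV z = sample (thetaMod z) := by
  have h (c : ℚ) (k : ℤ) (u : ℤ) (hk : k = 2 * u + 13) (hc : c = (k : ℚ) ^ 2 / 104) :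
      thetaMod z u = (-1) ^ u * th13 c k z := by
    rw [thetaMod_intCast, thetaZ, hc, th13_eq, hk]
    push_cast
    ring
  have h1 := h (121 / 104) 11 (-1) (by norm_num) (by norm_num)
  have h3 := h (49 / 104) 7 (-3) (by norm_num) (by norm_num)
  have h9 := h (25 / 104) 5 (-4) (by norm_num) (by norm_num)
  have h8 := h (9 / 104) 3 (-5) (by norm_num) (by norm_num)
  have h11 := h (81 / 104) 9 (-2) (by norm_num) (by norm_num)
  have h7 := h (1 / 104) 1 (-6) (by norm_num) (by norm_num)
  push_cast at *
  rw [thetaMod_odd z] at h1 h3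
  change thetaMod z 9 = _ at h9
  change thetaMod z 8 = _ at h8
  change thetaMod z 11 = _ at h11
  change thetaMod z 7 = _ at h7
  funext i
  fin_cases i
  · change th13 (121 / 104) 11 z = thetaMod z 1
    linear_combination h1
  · change th13 (49 / 104) 7 z = thetaMod z 3
    linear_combination h3
  · change th13 (25 / 104) 5 z = thetaMod z 9
    linear_combination -h9
  · change -th13 (9 / 104) 3 z = thetaMod z 8
    linear_combination -h8
  · change th13 (81 / 104) 9 z = thetaMod z 11
    linear_combination -h11
  · change th13 (1 / 104) 1 z = thetaMod z 7
    linear_combination -h7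

theorem thetaMod_add_one (z : ℂ) :
    thetaMod (z + 1) = fun u => cexp (13 * Real.pi * I / 4) * tw 1 (thetaMod z) u := by
  funext u
  have h : ((u.val : ℤ) : ZMod 13) = u := by simp
  generalize (u.val : ℤ) = n at h
  rw [← h, tw, thetaMod_intCast, thetaMod_intCast, thetaZ, thetaZ]
  obtain ⟨t, ht⟩ : Even (n * (n + 13)) := by
    rw [Int.even_mul, Int.even_add]
    rcases Int.even_or_odd n with h | h
    · exact Or.inl h
    · right
      simp [Int.not_even_iff_odd.mpr h]
      decide
  have hθ : jacobiTheta₂ (1 / 2 + (2 * n + 13) * (z + 1) / 2) (13 * (z + 1)) =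
      jacobiTheta₂ (1 / 2 + (2 * n + 13) * z / 2) (13 * z) := by
    refine tsum_congr fun m => ?_
    rw [jacobiTheta₂_term, jacobiTheta₂_term, Complex.exp_eq_exp_iff_exists_int]
    obtain ⟨s, hs⟩ : Even (m * (m + 1)) := Int.even_mul_succ_self m
    refine ⟨n * m + 13 * s, ?_⟩
    have : (m : ℂ) * (m + 1) = s + s := by exact_mod_cast hs
    push_cast
    linear_combination 13 * Real.pi * I * this
  have hc : chi (7 * 1 * (n : ZMod 13) ^ 2) = cexp (2 * Real.pi * I * t / 13) := by
    have := ZMod.stdAddChar_coe (N := 13) t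
    rw [Nat.cast_ofNat] at this
    rw [← this]
    congr 1
    have h2 : (n : ZMod 13) * (n + 13) = t + t := by
      exact_mod_cast congrArg (Int.cast : ℤ → ZMod 13) ht
    have h13 : (13 : ZMod 13) = 0 := rfl
    linear_combination 7 * h2 - 7 * n * h13 + t * h13
  rw [hθ, hc]
  have e : cexp (Real.pi * I * (2 * n + 13) ^ 2 * (z + 1) / 52) = cexp (13 * Real.pi * I / 4) *
      cexp (2 * Real.pi * I * t / 13) * cexp (Real.pi * I * (2 * n + 13) ^ 2 * z / 52) := by
    rw [← Complex.exp_add, ← Complex.exp_add]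
    congr 1
    have : (n : ℂ) * (n + 13) = t + t := by exact_mod_cast ht
    linear_combination Real.pi * I / 13 * this
  rw [e]
  ring

theorem dft_thetaMod {z : ℂ} (hz : 0 < z.im) (w : ℤ) :
    ZMod.dft (thetaMod z) w =
      cexp (13 * Real.pi * I * z / 4) * jacobiTheta₂ (1 / 2 - w / 13 + z / 2) (z / 13) := by
  have hz' : 0 < (z / 13).im := by
    rw [show z / 13 = z / ((13 : ℝ) : ℂ) by norm_num, Complex.div_ofReal_im]
    positivity
  have hs := (summable_jacobiTheta₂_term_iff (1 / 2 - w / 13 + z / 2) (z / 13)).mpr hz'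
  let e := (Equiv.prodComm (Fin 13) ℤ).trans (Int.divModEquiv 13).symm
  have he := Summable.tsum_prod (e.summable_iff.mpr hs)
  simp only [Function.comp_apply] at he
  rw [jacobiTheta₂, ← e.tsum_eq, he, tsum_fintype, ZMod.dft_apply, Finset.mul_sum]
  refine Finset.sum_congr (ι := Fin 13) rfl fun r _ => ?_
  have hr : thetaMod z r = thetaZ z (r : ℕ) := rfl
  have hc : ZMod.stdAddChar (N := 13) (-HMul.hMul (α := ZMod 13) r (w : ZMod 13)) =
      cexp (-(2 * Real.pi * I * r * w / 13)) := by
    have := ZMod.stdAddChar_coe (N := 13) (-((r : ℕ) * w))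
    push_cast at this
    rw [show ((r : ℕ) : ZMod 13) = r from ZMod.natCast_zmod_val (n := 13) r] at this
    rw [this]
    ring_nf
  have h1 : (-1 : ℂ) ^ ((r : ℕ) : ℤ) = cexp (r * (Real.pi * I)) := by
    rw [Complex.exp_nat_mul, Complex.exp_pi_mul_I, zpow_natCast]
  rw [hr, hc, thetaZ, h1, smul_eq_mul, jacobiTheta₂, ← tsum_mul_left, ← tsum_mul_left,
    ← tsum_mul_left]
  refine tsum_congr fun n => ?_
  change _ = _ * jacobiTheta₂_term (n * 13 + (r : ℕ)) _ _
  simp only [jacobiTheta₂_term, ← Complex.exp_add]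
  rw [Complex.exp_eq_exp_iff_exists_int]
  refine ⟨w * n - 6 * n, ?_⟩
  push_cast
  ring

theorem thetaMod_neg_inv {z : ℂ} (hz : 0 < z.im) :
    thetaMod (-1 / z) = fun w => (-I * (-I * (z / 13)) ^ (1 / 2 : ℂ)) * ZMod.dft (thetaMod z) w :=
      by
  have hz0 : z ≠ 0 := by rintro rfl; simp at hz
  funext w
  have h : ((w.val : ℤ) : ZMod 13) = w := by simp
  generalize (w.val : ℤ) = n at h
  have hneg : thetaMod (-1 / z) n = -thetaZ (-1 / z) (-n) := by
    rw [← thetaMod_intCast, Int.cast_neg, thetaMod_odd, neg_neg]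
  have hθ : jacobiTheta₂ ((1 / 2 - n / 13 + z / 2) / (z / 13)) (-1 / (z / 13)) =
      jacobiTheta₂ (1 / 2 + (2 * ((-n : ℤ) : ℂ) + 13) * (-1 / z) / 2) (13 * (-1 / z)) := by
    have hper : Function.Periodic (jacobiTheta₂ · (13 * (-1 / z))) 1 :=
      fun x => jacobiTheta₂_add_left x _
    rw [← jacobiTheta₂_neg_left (1 / 2 + _)]
    refine Eq.trans ?_ (hper.nat_mul 7 _)
    congr 1
    · push_cast
      field_simp
      ring
    · field_simp
  have h1 : (-1 : ℂ) ^ (-n) = cexp (n * (Real.pi * I)) := by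
    rw [Complex.exp_int_mul, Complex.exp_pi_mul_I, zpow_neg, ← inv_zpow]
    norm_num
  rw [← h, hneg, dft_thetaMod hz, jacobiTheta₂_functional_equation, thetaZ, hθ, h1]
  have hp : (-I * (z / 13)) ^ (1 / 2 : ℂ) ≠ 0 := by
    rw [Ne, Complex.cpow_eq_zero_iff]
    simp [hz0]
  generalize (-I * (z / 13)) ^ (1 / 2 : ℂ) = C at hp
  have e : cexp (n * (Real.pi * I)) *
      cexp (Real.pi * I * (2 * ((-n : ℤ) : ℂ) + 13) ^ 2 * (-1 / z) / 52) =
      I * (cexp (13 * Real.pi * I * z / 4) *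
        cexp (-Real.pi * I * (1 / 2 - n / 13 + z / 2) ^ 2 / (z / 13))) := by
    have hI : I = cexp (13 * (Real.pi / 2 * I)) := by
      rw [show (13 : ℂ) = ((13 : ℕ) : ℂ) by norm_num, Complex.exp_nat_mul,
        Complex.exp_pi_div_two_mul_I]
      norm_num [pow_succ]
    nth_rw 3 [hI]
    simp only [← Complex.exp_add]
    congr 1
    push_cast
    field_simp
    ring
  rw [e]
  field_simp

theorem sample_const_mul (c : ℂ) (f : ZMod 13 → ℂ) :
    sample (fun u => c * f u) = fun i => c * sample f i := by
  funext i
  fin_cases i <;> rfl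

theorem etaF_eq_eta (z : ℂ) : etaF z = ModularForm.eta z := by
  simp only [etaF, ModularForm.eta, ModularForm.eta_q_eq_pow, Function.Periodic.qParam]
  congr 2

theorem Phi18_xV (z : ℂ) : Phi18 (xV z) = etaF z ^ 18 * Phi18 (sample (thetaMod z)) := by
  rw [← AV_eq_sample]
  exact Phi18_smul (etaF z) (AV z)

theorem etaF_add_one (z : ℂ) : etaF (z + 1) = cexp (Real.pi * I / 12) * etaF z := by
  have h : cexp (2 * Real.pi * I * (z + 1)) = cexp (2 * Real.pi * I * z) := by
    rw [mul_add, mul_one, Complex.exp_periodic]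
  rw [etaF, etaF, h, ← mul_assoc, ← Complex.exp_add]
  congr 2
  ring

theorem Phi18_xV_add_one (z : ℂ) : Phi18 (xV (z + 1)) = Phi18 (xV z) := by
  have h : cexp (Real.pi * I / 12) ^ 18 * cexp (13 * Real.pi * I / 4) ^ 18 = 1 := by
    rw [← Complex.exp_nat_mul, ← Complex.exp_nat_mul, ← Complex.exp_add, Complex.exp_eq_one_iff]
    refine ⟨30, ?_⟩
    push_cast
    ring
  rw [Phi18_xV, Phi18_xV, etaF_add_one, thetaMod_add_one, sample_const_mul, Phi18_smul,
    ← rotate_sample, Phi18_rotate]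
  linear_combination (etaF z ^ 18 * Phi18 (sample (thetaMod z))) * h

theorem Phi18_xV_neg_inv {z : ℂ} (hz : 0 < z.im) :
    Phi18 (xV (-1 / z)) = z ^ 18 * Phi18 (xV z) := by
  have hz0 : z ≠ 0 := by rintro rfl; simp at hz
  have hη : etaF (-1 / z) ^ 18 = -I * z ^ 9 * etaF z ^ 18 := by
    have h := ModularForm.eta_comp_eq_csqrt_I_inv hz
    have hs (w : ℂ) (hw : w ≠ 0) : sqrt w ^ 18 = w ^ 9 := by
      rw [sqrt_eq_exp hw, ← Complex.exp_nat_mul]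
      nth_rw 2 [← Complex.exp_log hw]
      rw [← Complex.exp_nat_mul]
      congr 1
      push_cast
      ring
    simp only [Function.comp_apply, Pi.smul_apply, Pi.mul_apply, smul_eq_mul] at h
    rw [etaF_eq_eta, etaF_eq_eta, h, mul_pow, mul_pow, inv_pow, hs I I_ne_zero, hs z hz0]
    have hI : (I ^ 9)⁻¹ = -I := by
      rw [show I ^ 9 = I ^ 4 * I ^ 4 * I by ring, I_pow_four]
      simp
    rw [hI]
    ring
  have hC : ((-I * (z / 13)) ^ (1 / 2 : ℂ)) ^ 18 = (-I * (z / 13)) ^ 9 := by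
    rw [← Complex.cpow_nat_mul, ← Complex.cpow_natCast]
    congr 1
    norm_num
  rw [Phi18_xV, Phi18_xV, hη, thetaMod_neg_inv hz, sample_const_mul, Phi18_smul,
    Phi18_sample_dft (thetaMod_odd z), mul_pow _ _ 18, hC]
  have h2 : (-I) ^ 28 = 1 := by
    rw [show (-I) ^ 28 = (I ^ 4) ^ 7 by ring, I_pow_four, one_pow]
  rw [mul_pow, div_pow]
  linear_combination (z ^ 18 * etaF z ^ 18 * Phi18 (sample (thetaMod z))) * h2
theorem differentiable_Phi18 : Differentiable ℂ Phi18 := by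
  obtain ⟨d0, d1, d2, d3, d4, d5, d6, d7, d8, d9, d10, d11, d12, di⟩ :
      Differentiable ℂ (fun v => DD0 v) ∧ Differentiable ℂ (fun v => DD1 v) ∧
      Differentiable ℂ (fun v => DD2 v) ∧ Differentiable ℂ (fun v => DD3 v) ∧
      Differentiable ℂ (fun v => DD4 v) ∧ Differentiable ℂ (fun v => DD5 v) ∧
      Differentiable ℂ (fun v => DD6 v) ∧ Differentiable ℂ (fun v => DD7 v) ∧
      Differentiable ℂ (fun v => DD8 v) ∧ Differentiable ℂ (fun v => DD9 v) ∧
      Differentiable ℂ (fun v => DD10 v) ∧ Differentiable ℂ (fun v => DD11 v) ∧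
      Differentiable ℂ (fun v => DD12 v) ∧ Differentiable ℂ (fun v => DDinf v) := by
    simp only [DD0, DD1, DD2, DD3, DD4, DD5, DD6, DD7, DD8, DD9, DD10, DD11, DD12, DDinf]
    refine ⟨?_, ?_, ?_, ?_, ?_, ?_, ?_, ?_, ?_, ?_, ?_, ?_, ?_, ?_⟩ <;> fun_prop
  have hG : Differentiable ℂ (fun v => GG0 v) ∧ Differentiable ℂ (fun v => GG1 v) ∧
      Differentiable ℂ (fun v => GG2 v) ∧ Differentiable ℂ (fun v => GG3 v) ∧
      Differentiable ℂ (fun v => GG4 v) ∧ Differentiable ℂ (fun v => GG5 v) ∧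
      Differentiable ℂ (fun v => GG6 v) ∧ Differentiable ℂ (fun v => GG7 v) ∧
      Differentiable ℂ (fun v => GG8 v) ∧ Differentiable ℂ (fun v => GG9 v) ∧
      Differentiable ℂ (fun v => GG10 v) ∧ Differentiable ℂ (fun v => GG11 v) ∧
      Differentiable ℂ (fun v => GG12 v) := by
    simp only [GG0, GG1, GG2, GG3, GG4, GG5, GG6, GG7, GG8, GG9, GG10, GG11, GG12]
    refine ⟨?_, ?_, ?_, ?_, ?_, ?_, ?_, ?_, ?_, ?_, ?_, ?_, ?_⟩ <;> fun_prop
  obtain ⟨g0, g1, g2, g3, g4, g5, g6, g7, g8, g9, g10, g11, g12⟩ := hG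
  have h (ν : ℕ) : Differentiable ℂ (fun v => dF ν v) := by
    simp only [dF]
    fun_prop
  have hi : Differentiable ℂ (fun v => dInf v) := by
    simp only [dInf]
    fun_prop
  have : Differentiable ℂ (fun v => Phi18 v) := by
    simp only [Phi18]
    fun_prop
  exact this

theorem dF_line (ν : ℕ) (t : ℂ) : dF ν ![0, 0, 0, t, 0, 1] =
    -ζ ^ (4 * ν) - 2 * t * ζ ^ (5 * ν) + t ^ 2 * (2 * ζ ^ (6 * ν) - 2 * t * ζ ^ (7 * ν)
      - 10 * t ^ 2 * ζ ^ (8 * ν) + 4 * t ^ 3 * ζ ^ (9 * ν) - t ^ 4 * ζ ^ (10 * ν)) := by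
  have e0 : (![0, 0, 0, t, 0, 1] : Fin 6 → ℂ) 0 = 0 := rfl
  have e1 : (![0, 0, 0, t, 0, 1] : Fin 6 → ℂ) 1 = 0 := rfl
  have e2 : (![0, 0, 0, t, 0, 1] : Fin 6 → ℂ) 2 = 0 := rfl
  have e3 : (![0, 0, 0, t, 0, 1] : Fin 6 → ℂ) 3 = t := rfl
  have e4 : (![0, 0, 0, t, 0, 1] : Fin 6 → ℂ) 4 = 0 := rfl
  have e5 : (![0, 0, 0, t, 0, 1] : Fin 6 → ℂ) 5 = 1 := rfl
  simp only [dF, GG0, GG1, GG2, GG3, GG4, GG5, GG6, GG7, GG8, GG9, GG10, GG11, GG12, DD0, DD1,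
      DD2, DD3, DD4, DD5, DD6, DD7, DD8, DD9, DD10, DD11, DD12, DDinf, e0, e1, e2, e3, e4, e5]
  ring

theorem zeta_pow_thirteen : ζ ^ 13 = 1 := by
  rw [← chi_natCast]
  exact AddChar.map_zero_eq_one _

theorem Phi18_cusp : Phi18 ![0, 0, 0, 0, 0, 1] = 0 := by
  have h (ν : ℕ) : dF ν ![0, 0, 0, 0, 0, 1] ^ 3 = -chi 12 ^ ν := by
    rw [dF_line, ← Nat.cast_ofNat (n := 12), chi_natCast]
    ring
  have hi : dInf ![0, 0, 0, 0, 0, 1] = 0 := by simp [dInf, GG0, DD0, DDinf]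
  rw [Phi18, hi, Finset.sum_congr rfl fun ν _ => h ν, Finset.sum_neg_distrib,
    chi_geom_sum (by decide)]
  simp

theorem hasDerivAt_Phi18_line :
    HasDerivAt (fun t : ℂ => Phi18 ![0, 0, 0, t, 0, 1]) (-1) 0 := by
  have hi (t : ℂ) : dInf ![0, 0, 0, t, 0, 1] = 0 := by simp [dInf, GG0, DD0, DDinf]
  have h (ν : ℕ) : HasDerivAt (fun t : ℂ => dF ν ![0, 0, 0, t, 0, 1] ^ 3) (-6) 0 := by
    have hd : HasDerivAt (fun t : ℂ => dF ν ![0, 0, 0, t, 0, 1]) (-2 * ζ ^ (5 * ν)) 0 := by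
      simp only [dF_line]
      have h1 := ((hasDerivAt_id (0 : ℂ)).const_mul 2).mul_const (ζ ^ (5 * ν))
      have h2 : HasDerivAt (fun t : ℂ => t ^ 2 * (2 * ζ ^ (6 * ν) - 2 * t * ζ ^ (7 * ν)
          - 10 * t ^ 2 * ζ ^ (8 * ν) + 4 * t ^ 3 * ζ ^ (9 * ν) - t ^ 4 * ζ ^ (10 * ν))) 0 0 := by
        have hq : DifferentiableAt ℂ (fun t : ℂ => 2 * ζ ^ (6 * ν) - 2 * t * ζ ^ (7 * ν)
          - 10 * t ^ 2 * ζ ^ (8 * ν) + 4 * t ^ 3 * ζ ^ (9 * ν) - t ^ 4 * ζ ^ (10 * ν)) 0 := by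
          fun_prop
        simpa using (hasDerivAt_pow 2 (0 : ℂ)).fun_mul hq.hasDerivAt
      have h3 := (((hasDerivAt_const (0 : ℂ) (-ζ ^ (4 * ν))).sub h1).add h2)
      convert! h3 using 1
      ring
    have h3 := hd.pow 3
    convert! h3 using 1
    have hζ : ζ ^ (13 * ν) = 1 := by rw [pow_mul, zeta_pow_thirteen, one_pow]
    rw [dF_line]
    push_cast
    linear_combination (-6 : ℂ) * hζ.symm
  have hs := (HasDerivAt.fun_sum fun ν (_ : ν ∈ Finset.range 13) => h ν).const_mul (1 / (13 *
    6) : ℂ)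
  simp only [Phi18, hi]
  convert! hs using 1
  · funext t
    ring
  · norm_num

theorem tendsto_Phi18_div {α : Type*} {l : Filter α} {s : α → ℂ} {w : α → Fin 6 → ℂ} {a : ℂ}
    (hs0 : ∀ x, s x ≠ 0) (hs : Filter.Tendsto s l (nhds 0))
    (hw : Filter.Tendsto w l (nhds ![0, 0, 0, a, 0, 0])) :
    Filter.Tendsto (fun x => (s x)⁻¹ * Phi18 (![0, 0, 0, 0, 0, 1] + s x • w x)) l (nhds (-a)) := by
  have hf := (differentiable_Phi18 ![0, 0, 0, 0, 0, 1]).hasFDerivAt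
  set f' := fderiv ℂ Phi18 ![0, 0, 0, 0, 0, 1] with hf'
  have hv : f' ![0, 0, 0, a, 0, 0] = -a := by
    have hl : HasDerivAt (fun t : ℂ => (![0, 0, 0, t, 0, 1] : Fin 6 → ℂ)) ![0, 0, 0, 1, 0, 0] 0 :=
      by
      rw [hasDerivAt_pi]
      intro i
      fin_cases i
      · exact hasDerivAt_const _ _
      · exact hasDerivAt_const _ _
      · exact hasDerivAt_const _ _
      · exact hasDerivAt_id _
      · exact hasDerivAt_const _ _
      · exact hasDerivAt_const _ _
    have h0 : HasDerivAt (fun t : ℂ => Phi18 ![0, 0, 0, t, 0, 1]) (f' ![0, 0, 0, 1, 0, 0]) 0 :=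
      HasFDerivAt.comp_hasDerivAt (l := Phi18) (0 : ℂ) hf hl
    have h1 := h0.unique hasDerivAt_Phi18_line
    have h2 : (![0, 0, 0, a, 0, 0] : Fin 6 → ℂ) = a • ![0, 0, 0, 1, 0, 0] := by
      simp
    rw [h2, map_smul, h1, smul_eq_mul, mul_neg_one]
  have h := (hasFDerivWithinAt_univ.2 hf).lim (l := l) (c := fun x => (s x)⁻¹)
    (d := fun x => s x • w x) (v := ![0, 0, 0, a, 0, 0])
    (by simpa using hs.smul hw) (.of_forall fun _ => Set.mem_univ _)
    (by simpa only [inv_smul_smul₀ (hs0 _)] using hw)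
  simpa only [Phi18_cusp, sub_zero, smul_eq_mul, hv] using h

/-- The theta series of index `k` with its leading power of `q` removed. -/
def thetaTail (k : ℤ) (z : ℂ) : ℂ := jacobiTheta₂ (1 / 2 + k * z / 2) (13 * z)

theorem differentiableAt_thetaTail (k : ℤ) {z : ℂ} (hz : 0 < z.im) :
    DifferentiableAt ℂ (thetaTail k) z := by
  have h13 : 0 < (13 * z).im := by simpa using hz
  have h := (hasFDerivAt_jacobiTheta₂ (1 / 2 + k * z / 2) h13).differentiableAt
  have hg : DifferentiableAt ℂ (fun z : ℂ => (1 / 2 + k * z / 2, 13 * z)) z := by fun_prop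
  exact DifferentiableAt.comp (g := fun p : ℂ × ℂ => jacobiTheta₂ p.1 p.2) z h hg

theorem norm_jacobiTheta₂_term_thetaTail (k n : ℤ) (z : ℂ) :
    ‖jacobiTheta₂_term n (1 / 2 + k * z / 2) (13 * z)‖ =
      Real.exp (-Real.pi * (z.im * (13 * n ^ 2 + k * n : ℤ))) := by
  rw [norm_jacobiTheta₂_term]
  congr 1
  have h1 : (13 * z).im = 13 * z.im := by simp
  have h2 : (1 / 2 + k * z / 2).im = k * z.im / 2 := by simp
  rw [h1, h2]
  push_cast
  ring

theorem tendsto_thetaTail {k : ℤ} (hk0 : 0 ≤ k) (hk : k ≤ 12) :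
    Filter.Tendsto (fun τ : UpperHalfPlane => thetaTail k τ) UpperHalfPlane.atImInfty (nhds 1) := by
  have hb (n : ℤ) : n ^ 2 ≤ 13 * n ^ 2 + k * n := by
    rcases le_total 0 n with hn | hn
    · nlinarith
    · rcases hn.lt_or_eq with hn' | rfl
      · nlinarith
      · simp
  have hbound : Summable fun n : ℤ => Real.exp (-Real.pi * (n : ℝ) ^ 2) := by
    have := ((summable_jacobiTheta₂_term_iff 0 I).mpr (by simp)).norm
    simpa [norm_jacobiTheta₂_term] using this
  have hpt (n : ℤ) : Filter.Tendsto
      (fun τ : UpperHalfPlane => jacobiTheta₂_term n (1 / 2 + k * (τ : ℂ) / 2) (13 * τ))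
      UpperHalfPlane.atImInfty (nhds (if n = 0 then 1 else 0)) := by
    split_ifs with hn
    · subst hn
      simp [jacobiTheta₂_term]
    · rw [tendsto_zero_iff_norm_tendsto_zero]
      simp only [norm_jacobiTheta₂_term_thetaTail]
      have hpos : (0 : ℝ) < (13 * n ^ 2 + k * n : ℤ) := by
        have := (pow_pos (abs_pos.mpr hn) 2).trans_le ((sq_abs n).le.trans (hb n))
        exact_mod_cast this
      refine Real.tendsto_exp_atBot.comp ?_
      refine Filter.Tendsto.const_mul_atTop_of_neg (by simpa using Real.pi_pos) ?_
      exact (Filter.tendsto_comap (f := UpperHalfPlane.im)).atTop_mul_const hpos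
  have h := tendsto_tsum_of_dominated_convergence hbound hpt ?_
  · simpa only [tsum_ite_eq, thetaTail, jacobiTheta₂] using h
  · have h1 : ∀ᶠ τ : UpperHalfPlane in UpperHalfPlane.atImInfty, 1 ≤ τ.im :=
      Filter.tendsto_comap.eventually (Filter.eventually_ge_atTop 1)
    filter_upwards [h1] with τ hτ n
    rw [norm_jacobiTheta₂_term_thetaTail, Real.exp_le_exp]
    refine mul_le_mul_of_nonpos_left ?_ (by simpa using Real.pi_pos.le)
    have h2 : ((n ^ 2 : ℤ) : ℝ) ≤ (13 * n ^ 2 + k * n : ℤ) := by exact_mod_cast hb n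
    have h3 : (0 : ℝ) ≤ ((n ^ 2 : ℤ) : ℝ) := by exact_mod_cast sq_nonneg n
    change (n : ℝ) ^ 2 ≤ τ.im * _
    push_cast at *
    nlinarith

theorem tendsto_tprod_one_sub_eta_q : Filter.Tendsto
    (fun τ : UpperHalfPlane => ∏' n, (1 - ModularForm.eta_q n τ))
    UpperHalfPlane.atImInfty (nhds 1) := by
  have h : Filter.Tendsto (fun q : ℂ ↦ ∏' n : ℕ, (1 - q ^ (n + 1))) (nhds 0) (nhds 1) := by
    have := tendsto_tprod_one_add_of_dominated_convergence (𝓕 := nhds 0) (g := 0)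
      (f := fun (q : ℂ) (n : ℕ) ↦ -q ^ (n + 1)) (bound := fun n ↦ (1 / 2 : ℝ) ^ (n + 1))
    simp only [Pi.zero_apply, norm_neg, norm_pow, add_zero, tprod_one] at this
    simp_rw [sub_eq_add_neg]
    refine this
      (by simpa only [pow_succ'] using (summable_geometric_of_abs_lt_one (by norm_num)).mul_left _)
      (fun k ↦ by simpa using ((continuous_pow (M := ℂ) (k + 1)).tendsto 0).neg) ?_
    filter_upwards [Metric.ball_mem_nhds (0 : ℂ) (by norm_num : (0 : ℝ) < 1 / 2)] with q hq k
    exact pow_le_pow_left₀ (norm_nonneg _) (mem_ball_zero_iff.mp hq).le _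
  simpa only [ModularForm.eta_q_eq_pow, Function.Periodic.qParam, Function.comp_def, ofReal_one,
    div_one] using h.comp (UpperHalfPlane.qParam_tendsto_atImInfty zero_lt_one)

theorem xV_apply (z : ℂ) (i : Fin 6) : xV z i = etaF z * AV z i := rfl

theorem AV_eq_thetaTail (z : ℂ) : AV z = fun i =>
    ![cexp (Real.pi * I * 121 * z / 52) * thetaTail 11 z,
      cexp (Real.pi * I * 49 * z / 52) * thetaTail 7 z,
      cexp (Real.pi * I * 25 * z / 52) * thetaTail 5 z,
      -(cexp (Real.pi * I * 9 * z / 52) * thetaTail 3 z),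
      cexp (Real.pi * I * 81 * z / 52) * thetaTail 9 z,
      cexp (Real.pi * I * 1 * z / 52) * thetaTail 1 z] i := by
  have h (c : ℚ) (k : ℤ) (hc : c = (k : ℚ) ^ 2 / 104) :
      th13 c k z = cexp (Real.pi * I * (k ^ 2 : ℤ) * z / 52) * thetaTail k z := by
    rw [hc, th13_eq, thetaTail]
    push_cast
    rfl
  have h1 := h (121 / 104) 11 (by norm_num)
  have h2 := h (49 / 104) 7 (by norm_num)
  have h3 := h (25 / 104) 5 (by norm_num)
  have h4 := h (9 / 104) 3 (by norm_num)
  have h5 := h (81 / 104) 9 (by norm_num)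
  have h6 := h (1 / 104) 1 (by norm_num)
  norm_num at h1 h2 h3 h4 h5 h6
  funext i
  fin_cases i
  · exact h1
  · exact h2
  · exact h3
  · exact congrArg Neg.neg h4
  · exact h5
  · simpa [AV, ta] using h6

theorem differentiableAt_Phi18_xV {z : ℂ} (hz : 0 < z.im) :
    DifferentiableAt ℂ (fun z => Phi18 (xV z)) z := by
  refine DifferentiableAt.comp (g := Phi18) z (differentiable_Phi18 _) ?_
  have hη : DifferentiableAt ℂ etaF z := by
    rw [show etaF = ModularForm.eta from funext etaF_eq_eta]
    exact ModularForm.differentiableAt_eta_of_mem_upperHalfPlaneSet hz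
  have ht (k : ℤ) := differentiableAt_thetaTail k hz
  rw [differentiableAt_pi]
  intro i
  simp only [xV_apply, AV_eq_thetaTail]
  refine hη.fun_mul ?_
  have h1 := ht 1
  have h3 := ht 3
  have h5 := ht 5
  have h7 := ht 7
  have h9 := ht 9
  have h11 := ht 11
  fin_cases i <;> simp <;> fun_prop

theorem tendsto_Phi18_xV_div : Filter.Tendsto
    (fun τ : UpperHalfPlane => Phi18 (xV τ) / ModularForm.discriminant τ)
    UpperHalfPlane.atImInfty (nhds 1) := by
  have hs : Filter.Tendsto (fun τ : UpperHalfPlane => cexp (2 * Real.pi * I * τ / 13))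
      UpperHalfPlane.atImInfty (nhds 0) := by
    simpa [Function.Periodic.qParam] using
      UpperHalfPlane.qParam_tendsto_atImInfty (h := 13) (by norm_num)
  have h1 := tendsto_thetaTail (k := 1) (by norm_num) (by norm_num)
  have h3 := tendsto_thetaTail (k := 3) (by norm_num) (by norm_num)
  have h5 := tendsto_thetaTail (k := 5) (by norm_num) (by norm_num)
  have h7 := tendsto_thetaTail (k := 7) (by norm_num) (by norm_num)
  have h9 := tendsto_thetaTail (k := 9) (by norm_num) (by norm_num)
  have h11 := tendsto_thetaTail (k := 11) (by norm_num) (by norm_num)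
  set s : UpperHalfPlane → ℂ := fun τ => cexp (2 * Real.pi * I * τ / 13) with hs_def
  let w : UpperHalfPlane → Fin 6 → ℂ := fun τ =>
    ![s τ ^ 14 * thetaTail 11 τ / thetaTail 1 τ, s τ ^ 5 * thetaTail 7 τ / thetaTail 1 τ,
      s τ ^ 2 * thetaTail 5 τ / thetaTail 1 τ, -thetaTail 3 τ / thetaTail 1 τ,
      s τ ^ 9 * thetaTail 9 τ / thetaTail 1 τ, 0]
  have hw : Filter.Tendsto w UpperHalfPlane.atImInfty (nhds ![0, 0, 0, -1, 0, 0]) := by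
    rw [tendsto_pi_nhds]
    have h (n : ℕ) (hn : n ≠ 0) {f : UpperHalfPlane → ℂ}
        (hf : Filter.Tendsto f UpperHalfPlane.atImInfty (nhds 1)) :
        Filter.Tendsto (fun τ => s τ ^ n * f τ / thetaTail 1 τ) UpperHalfPlane.atImInfty
          (nhds 0) := by
      have h : Filter.Tendsto (fun τ => s τ ^ n * f τ / thetaTail 1 τ) UpperHalfPlane.atImInfty
          (nhds (0 ^ n * 1 / 1)) := ((hs.pow n).mul hf).div h1 one_ne_zero
      simpa [hn] using h
    intro i
    fin_cases i
    · exact h 14 (by norm_num) h11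
    · exact h 5 (by norm_num) h7
    · exact h 2 (by norm_num) h5
    · have h : Filter.Tendsto (fun τ : UpperHalfPlane => -thetaTail 3 τ / thetaTail 1 τ)
          UpperHalfPlane.atImInfty (nhds (-1 / 1)) := h3.neg.div h1 one_ne_zero
      rwa [div_one] at h
    · exact h 9 (by norm_num) h9
    · exact tendsto_const_nhds
  have hmain := tendsto_Phi18_div (s := s) (fun τ => Complex.exp_ne_zero _) hs hw
  rw [neg_neg] at hmain
  have hlim : Filter.Tendsto
      (fun τ : UpperHalfPlane => thetaTail 1 τ ^ 18 / (∏' n, (1 - ModularForm.eta_q n τ)) ^ 6 *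
        ((s τ)⁻¹ * Phi18 (![0, 0, 0, 0, 0, 1] + s τ • w τ)))
      UpperHalfPlane.atImInfty (nhds (1 ^ 18 / 1 ^ 6 * 1)) :=
    ((h1.pow 18).div (tendsto_tprod_one_sub_eta_q.pow 6) (by simp)).mul hmain
  rw [one_pow, one_pow, div_one, mul_one] at hlim
  refine hlim.congr' ?_
  filter_upwards [h1.eventually_ne one_ne_zero] with τ hτ
  have hAV : AV τ = fun i => (cexp (Real.pi * I * τ / 52) * thetaTail 1 τ) *
      ((![0, 0, 0, 0, 0, 1] : Fin 6 → ℂ) + s τ • w τ) i := by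
    have he (m : ℂ) (n : ℕ) (hm : m = 8 * n + 1) :
        cexp (Real.pi * I * m * τ / 52) = cexp (Real.pi * I * τ / 52) * s τ ^ n := by
      rw [hs_def, ← Complex.exp_nat_mul, ← Complex.exp_add, hm]
      congr 1
      ring
    rw [AV_eq_thetaTail, he 121 15 (by norm_num), he 49 6 (by norm_num), he 25 3 (by norm_num),
      he 9 1 (by norm_num), he 81 10 (by norm_num), he 1 0 (by norm_num)]
    funext i
    fin_cases i <;> simp [w] <;> field_simp
  have hη : etaF τ = cexp (2 * Real.pi * I * τ / 24) * ∏' n, (1 - ModularForm.eta_q n τ) := by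
    rw [etaF_eq_eta, ModularForm.eta, Function.Periodic.qParam]
    norm_num
  have hη0 : etaF τ ≠ 0 := by
    rw [etaF_eq_eta]
    exact ModularForm.eta_ne_zero τ.2
  have hP : Phi18 (xV τ) = etaF τ ^ 18 * Phi18 (AV τ) := Phi18_smul (etaF τ) (AV τ)
  have hE0 : ∏' n, (1 - ModularForm.eta_q n τ) ≠ 0 := right_ne_zero_of_mul (hη ▸ hη0)
  rw [hP, ModularForm.discriminant, ← etaF_eq_eta, hAV, Phi18_smul,
    show etaF τ ^ 24 = etaF τ ^ 18 * etaF τ ^ 6 by ring, mul_div_mul_left _ _ (pow_ne_zero _ hη0),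
    hη, mul_pow, mul_pow]
  have hexp : cexp (Real.pi * I * τ / 52) ^ 18 * s τ = cexp (2 * Real.pi * I * τ / 24) ^ 6 := by
    rw [hs_def, ← Complex.exp_nat_mul, ← Complex.exp_nat_mul, ← Complex.exp_add]
    congr 1
    push_cast
    ring
  rw [← hexp]
  have hs0 : s τ ≠ 0 := Complex.exp_ne_zero _
  have hc0 : cexp (Real.pi * I * τ / 52) ≠ 0 := Complex.exp_ne_zero _
  field_simp

open UpperHalfPlane ModularForm MatrixGroups in
theorem Phi18_xV_slash (γ : SL(2, ℤ)) :
    (fun τ : ℍ => Phi18 (xV τ)) ∣[(18 : ℤ)] γ = fun τ : ℍ => Phi18 (xV τ) := by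
  refine SlashInvariantForm.slash_action_generators_SL2Z ?_ ?_ γ
  · ext τ
    have h := Phi18_xV_neg_inv τ.im_pos
    have h0 : (τ : ℂ) ≠ 0 := τ.ne_zero
    rw [show (-1 / (τ : ℂ)) = (-(τ : ℂ))⁻¹ by rw [inv_neg, neg_div, one_div]] at h
    rw [SL_slash_def]
    simp only [UpperHalfPlane.modular_S_smul, ModularGroup.denom_S, h]
    rw [zpow_neg, zpow_ofNat]
    field_simp
  · ext τ
    rw [SL_slash_def]
    simp only [UpperHalfPlane.modular_T_smul, ModularGroup.denom_apply]
    simp [ModularGroup.T, Phi18_xV_add_one, add_comm (1 : ℂ)]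

open UpperHalfPlane ModularForm MatrixGroups in
theorem Phi18_xV_div_discriminant_slash (γ : SL(2, ℤ)) :
    (fun τ : ℍ => Phi18 (xV τ) / discriminant τ) ∣[(6 : ℤ)] γ =
      fun τ : ℍ => Phi18 (xV τ) / discriminant τ := by
  have hγ : (γ : GL (Fin 2) ℝ) ∈ 𝒮ℒ := ⟨γ, rfl⟩
  have hΔ : (⇑CuspForm.discriminant) ∣[(12 : ℤ)] γ = ⇑CuspForm.discriminant := by
    rw [SL_slash, SlashInvariantForm.slash_action_eqn _ _ hγ]
  change ((fun τ : ℍ => Phi18 (xV τ)) / ⇑CuspForm.discriminant) ∣[(18 - 12 : ℤ)] γ =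
    (fun τ : ℍ => Phi18 (xV τ)) / ⇑CuspForm.discriminant
  rw [div_slash_SL2, Phi18_xV_slash, hΔ]

open UpperHalfPlane ModularForm MatrixGroups in
/-- The level-one form `Φ₁₈(x(τ)) / Δ(τ)` of weight six. -/
def phiDivDiscriminant : ModularForm 𝒮ℒ 6 where
  toFun τ := Phi18 (xV τ) / ModularForm.discriminant τ
  slash_action_eq' := fun _ ⟨γ, hγ⟩ => hγ ▸ Phi18_xV_div_discriminant_slash γ
  holo' := by
    refine MDifferentiable.div ?_ CuspForm.discriminant.holo' discriminant_ne_zero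
    rw [UpperHalfPlane.mdifferentiable_iff]
    refine DifferentiableOn.congr (f := fun z => Phi18 (xV z)) (fun z hz =>
      (differentiableAt_Phi18_xV hz).differentiableWithinAt) fun z hz => ?_
    simp [ofComplex_apply_of_im_pos hz]
  bdd_at_cusps' {c} hc := by
    rw [Subgroup.IsArithmetic.isCusp_iff_isCusp_SL2Z] at hc
    rw [OnePoint.isBoundedAt_iff_forall_SL2Z hc]
    intro γ _
    rw [Phi18_xV_div_discriminant_slash γ, IsBoundedAtImInfty, Filter.BoundedAtFilter]
    exact tendsto_Phi18_xV_div.isBigO_one ℝ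

open UpperHalfPlane ModularForm in
theorem phiDivDiscriminant_eq_E : phiDivDiscriminant = E (k := 6) (by norm_num) := by
  have hE := EisensteinSeries.E_qExpansion_coeff_zero (k := 6) (by norm_num) ⟨3, rfl⟩
  have hE0 : E (k := 6) (by norm_num) ≠ 0 := EisensteinSeries.E_ne_zero _ ⟨3, rfl⟩
  obtain ⟨c, hc⟩ := (finrank_eq_one_iff_of_nonzero' (E (k := 6) (by norm_num)) hE0).mp
    (Module.rank_eq_one_iff_finrank_eq_one.mp levelOne_weight_six_rank_one) phiDivDiscriminant
  have h1 : (qExpansion 1 phiDivDiscriminant).coeff 0 = 1 := by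
    rw [UpperHalfPlane.qExpansion_coeff_zero one_pos
      (ModularFormClass.analyticAt_cuspFunction_zero _ one_pos one_mem_strictPeriods_SL)
      (SlashInvariantFormClass.periodic_comp_ofComplex _ one_mem_strictPeriods_SL)]
    exact tendsto_Phi18_xV_div.limUnder_eq
  have hc1 : c = 1 := by
    rw [← hc, FunLike.coe_smul, ModularForm.qExpansion_smul one_pos one_mem_strictPeriods_SL,
      PowerSeries.coeff_smul, hE] at h1
    simpa using h1
  rw [← hc, hc1, one_smul]

open UpperHalfPlane ModularForm in
theorem Eis_eq_E (τ : ℍ) : Eis 6 τ = E (k := 6) (by norm_num) τ := by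
  have : E (k := 6) (by norm_num) τ = (1 / 2 : ℂ) * eisensteinSeries (N := 1) 0 6 τ := rfl
  rw [this, Eis, eisensteinSeries]
  congr 1
  let e : {p : ℤ × ℤ // Int.gcd p.1 p.2 = 1} ≃ EisensteinSeries.gammaSet 1 1 0 :=
    (finTwoArrowEquiv ℤ).symm.subtypeEquiv fun p => by
      rw [EisensteinSeries.gammaSet_one_mem_iff]; simp
  rw [← e.tsum_eq]
  refine tsum_congr fun p => ?_
  simp [e, EisensteinSeries.eisSummand, zpow_neg]

theorem stmt11 (z : ℂ) (hz : 0 < z.im) : Phi18 (xV z) = Δfun z * Eis 6 z := by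
  lift z to UpperHalfPlane using hz
  have h := congrArg (fun f => f z) phiDivDiscriminant_eq_E
  change Phi18 (xV z) / ModularForm.discriminant z = _ at h
  rw [div_eq_iff (ModularForm.discriminant_ne_zero z)] at h
  rw [h, Eis_eq_E, Δfun, etaF_eq_eta, mul_comm]
  rfl
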